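/- Let a normal-form feasible schedule of the constructed instance with makespan W be given in which the job processed on machine 2 with start time 0 belongs to B. Then for every i ∈ {0,…,z}: #_{A_i} {λ_1} = 1 and #_{A_i} B − #_{A_i} {λ_1} = #_{A_i} A (= i); in particular λ_1 finishes before every job of A starts, and the jobs of A and B alternate. -/

import Mathlib

/-- Jobs of the instance constructed from a 3-Partition instance with parameter `z`. -/
inductive Job (z : ℕ) : Type
  | JA (i : Fin (z+1))
  | JB (i : Fin (z+1))
  | Ja (i : Fin z)
  | Jb (i : Fin z)
  | Jc (j : Fin (z+1))
  | Jα (i : Fin z)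
  | Jβ (i : Fin z)
  | Jγ (j : Fin z)
  | Jδ (j : Fin z)
  | Jl1
  | Jl2
  | Jpart (i : Fin (3*z))
  deriving DecidableEq, Fintype

/-- Processing times of the constructed jobs (`γ_j`, `δ_j` use index `j ∈ {1,…,z}`,
represented by `j.val + 1` for `j : Fin z`). -/
def pJob (z D : ℕ) (ι : Fin (3*z) → ℕ) : Job z → ℕ
  | .JA _ => D^2
  | .JB _ => D^3
  | .Ja _ => D^4 + D^6 + 3*z*D^7
  | .Jb _ => D^5 + D^6 + 3*z*D^7
  | .Jc j => (z + j.val)*D^7 + D^8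
  | .Jα _ => D^3 + D^5 + 4*z*D^7 + D^8
  | .Jβ _ => D^2 + D^4 + (4*z-1)*D^7 + D^8
  | .Jγ j => D^5 + (3*z - (j.val+1))*D^7 - D
  | .Jδ j => D^4 + (3*z - (j.val+1))*D^7
  | .Jl1 => D^3 + z*D^7 + D^8
  | .Jl2 => D^2 + 2*z*D^7 + D^8
  | .Jpart i => ι i

/-- Machine requirements of the constructed jobs. -/
def qJob (z : ℕ) : Job z → ℕ
  | .JA _ => 3
  | .JB _ => 3
  | .Ja _ => 2
  | .Jb _ => 2
  | .Jc _ => 2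
  | _ => 1

/-- Feasibility of a schedule `(σ, ρ)` on machines `{1,…,m}`: every job gets `q j`
machines among `{1,…,m}`, and jobs sharing a machine have disjoint half-open intervals. -/
def Feasible {J : Type} (m : ℕ) (p q : J → ℕ) (σ : J → ℕ) (ρ : J → Finset ℕ) : Prop :=
  (∀ j, ρ j ⊆ Finset.Icc 1 m) ∧ (∀ j, (ρ j).card = q j) ∧
  (∀ j j', j ≠ j' → (ρ j ∩ ρ j').Nonempty →
    σ j + p j ≤ σ j' ∨ σ j' + p j' ≤ σ j)

/-- Makespan of a schedule. -/
def makespan {J : Type} [Fintype J] (p σ : J → ℕ) : ℕ :=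
  Finset.univ.sup fun j => σ j + p j

/-- The target makespan `W`. -/
def Wval (z D : ℕ) : ℕ :=
  (z+1)*(D^2 + D^3 + D^8) + z*(D^4 + D^5 + D^6) + z*(7*z+1)*D^7

/-- The 3-Partition instance `ι` is a Yes-instance. -/
def IsYes (z D : ℕ) (ι : Fin (3*z) → ℕ) : Prop :=
  ∃ f : Fin (3*z) → Fin z,
    ∀ k : Fin z, ∑ i ∈ Finset.univ.filter (fun i => f i = k), ι i = D

/-- Jobs processed on machine 1 in a normal-form schedule: `A ∪ a ∪ α ∪ {λ₁}`. -/
def M1Jobs {z : ℕ} : Job z → Prop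
  | .JA _ => True
  | .Ja _ => True
  | .Jα _ => True
  | .Jl1 => True
  | _ => False

/-- Jobs processed on machine 4 in a normal-form schedule: `B ∪ b ∪ β ∪ {λ₂}`. -/
def M4Jobs {z : ℕ} : Job z → Prop
  | .JB _ => True
  | .Jb _ => True
  | .Jβ _ => True
  | .Jl2 => True
  | _ => False

/-- Jobs processed on both machines 2 and 3: `A ∪ B ∪ c`. -/
def BothM23 {z : ℕ} : Job z → Prop
  | .JA _ => True
  | .JB _ => True
  | .Jc _ => True
  | _ => False

/-- Jobs processed on exactly one of machines 2 and 3: `a ∪ b ∪ γ ∪ δ ∪ P`. -/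
def OneM23 {z : ℕ} : Job z → Prop
  | .Ja _ => True
  | .Jb _ => True
  | .Jγ _ => True
  | .Jδ _ => True
  | .Jpart _ => True
  | _ => False

/-- Normal form of a schedule of the constructed instance. -/
def NormalForm {z : ℕ} (ρ : Job z → Finset ℕ) : Prop :=
  (∀ j, 1 ∈ ρ j ↔ M1Jobs j) ∧
  (∀ j, 4 ∈ ρ j ↔ M4Jobs j) ∧
  (∀ j, BothM23 j → 2 ∈ ρ j ∧ 3 ∈ ρ j) ∧
  (∀ j, OneM23 j → ((2 ∈ ρ j) ↔ ¬ (3 ∈ ρ j)))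

/-- `cnt p σ S i` = number of jobs of `S` finishing no later than the start of `i`
(the quantity `#ᵢ S`). -/
def cnt {z : ℕ} (p σ : Job z → ℕ) (S : Finset (Job z)) (i : Job z) : ℕ :=
  (S.filter fun j => σ j + p j ≤ σ i).card

def sA (z : ℕ) : Finset (Job z) := Finset.univ.image Job.JA
def sB (z : ℕ) : Finset (Job z) := Finset.univ.image Job.JB
def sa (z : ℕ) : Finset (Job z) := Finset.univ.image Job.Ja
def sb (z : ℕ) : Finset (Job z) := Finset.univ.image Job.Jb
def sc (z : ℕ) : Finset (Job z) := Finset.univ.image Job.Jc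
def sα (z : ℕ) : Finset (Job z) := Finset.univ.image Job.Jα
def sβ (z : ℕ) : Finset (Job z) := Finset.univ.image Job.Jβ
def sγ (z : ℕ) : Finset (Job z) := Finset.univ.image Job.Jγ
def sδ (z : ℕ) : Finset (Job z) := Finset.univ.image Job.Jδ

theorem pk_sum_le {J : Type} [DecidableEq J] (σ p : J → ℕ) (S : Finset J) (x y : ℕ)
    (hc : ∀ j ∈ S, ∀ j' ∈ S, j ≠ j' → σ j + p j ≤ σ j' ∨ σ j' + p j' ≤ σ j)
    (hx : ∀ j ∈ S, x ≤ σ j) (hy : ∀ j ∈ S, σ j + p j ≤ y) :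
    ∑ j ∈ S, p j ≤ y - x := by
  have h1 : (S.biUnion (fun j => Finset.Ico (σ j) (σ j + p j))).card = ∑ j ∈ S, p j := by
    rw [Finset.card_biUnion]
    · simp
    · intro j hj j' hj' hne
      refine Finset.disjoint_left.2 ?_
      intro t ht ht'
      simp only [Finset.mem_Ico] at ht ht'
      rcases hc j hj j' hj' hne with h | h <;> omega
  rw [← h1, ← Nat.card_Ico x y]
  apply Finset.card_le_card
  intro t ht
  simp only [Finset.mem_biUnion, Finset.mem_Ico] at ht ⊢
  obtain ⟨j, hj, h⟩ := ht
  have := hx j hj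
  have := hy j hj
  omega

theorem pk_start_eq {J : Type} [DecidableEq J] (σ p : J → ℕ) (S : Finset J) (W : ℕ)
    (hc : ∀ j ∈ S, ∀ j' ∈ S, j ≠ j' → σ j + p j ≤ σ j' ∨ σ j' + p j' ≤ σ j)
    (hy : ∀ j ∈ S, σ j + p j ≤ W) (ht : ∑ j ∈ S, p j = W) (i : J) (hi : i ∈ S) :
    ∑ j ∈ S with σ j + p j ≤ σ i, p j = σ i := by
  have h1 := pk_sum_le σ p (S.filter (fun j => σ j + p j ≤ σ i)) 0 (σ i)
    (fun j hj j' hj' => hc j (Finset.mem_filter.1 hj).1 j' (Finset.mem_filter.1 hj').1)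
    (fun _ _ => Nat.zero_le _) (fun j hj => (Finset.mem_filter.1 hj).2)
  have h2 := pk_sum_le σ p (S.filter (fun j => ¬ σ j + p j ≤ σ i)) (σ i) W
    (fun j hj j' hj' => hc j (Finset.mem_filter.1 hj).1 j' (Finset.mem_filter.1 hj').1)
    (fun j hj => by
      obtain ⟨hj, hn⟩ := Finset.mem_filter.1 hj
      by_cases h : j = i
      · subst h; exact le_rfl
      · rcases hc j hj i hi h with h | h <;> omega)
    (fun j hj => hy j (Finset.mem_filter.1 hj).1)
  have h3 := Finset.sum_filter_add_sum_filter_not S (fun j => σ j + p j ≤ σ i) p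
  have := hy i hi
  omega

def NN {J : Type} (σ p : J → ℕ) (S : Finset J) (t : ℕ) : ℕ :=
  (S.filter fun j => σ j + p j ≤ t).card

section NNlem
variable {J : Type} {σ p : J → ℕ} {S : Finset J}

theorem NN_mono {t t' : ℕ} (h : t ≤ t') : NN σ p S t ≤ NN σ p S t' := by
  apply Finset.card_le_card
  intro j hj
  simp only [Finset.mem_filter] at hj ⊢
  exact ⟨hj.1, hj.2.trans h⟩

theorem NN_le_card {t : ℕ} : NN σ p S t ≤ S.card := Finset.card_filter_le _ _

theorem NN_lt {t t' : ℕ} (j : J) (hj : j ∈ S) (h1 : t < σ j + p j) (h2 : σ j + p j ≤ t') :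
    NN σ p S t < NN σ p S t' := by
  apply Finset.card_lt_card
  rw [Finset.ssubset_iff_of_subset]
  · exact ⟨j, by simp [hj, h2], by simp [hj, h1]⟩
  · intro j hj
    simp only [Finset.mem_filter] at hj ⊢
    exact ⟨hj.1, by omega⟩

theorem NN_ex {t t' : ℕ} (h : NN σ p S t < NN σ p S t') :
    ∃ j ∈ S, t < σ j + p j ∧ σ j + p j ≤ t' := by
  by_contra hc
  push Not at hc
  have : NN σ p S t' ≤ NN σ p S t := by
    apply Finset.card_le_card
    intro j hj
    simp only [Finset.mem_filter] at hj ⊢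
    refine ⟨hj.1, ?_⟩
    by_contra h'
    have := hc j hj.1 (by omega)
    omega
  omega

theorem NN_self_lt (hp : ∀ j, 0 < p j) (j : J) (hj : j ∈ S) : NN σ p S (σ j) < S.card := by
  apply Finset.card_lt_card
  rw [Finset.ssubset_iff_of_subset (Finset.filter_subset _ _)]
  refine ⟨j, hj, ?_⟩
  have := hp j
  simp; intro _; omega

theorem NN_rank (hp : ∀ j, 0 < p j)
    (hc : ∀ j ∈ S, ∀ j' ∈ S, j ≠ j' → σ j + p j ≤ σ j' ∨ σ j' + p j' ≤ σ j)
    (n : ℕ) (hn : n < S.card) : ∃ j ∈ S, NN σ p S (σ j) = n := by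
  have hinj : Set.InjOn (fun j => NN σ p S (σ j)) S := by
    intro j hj j' hj' h
    by_contra hne
    have := hp j
    have := hp j'
    simp only at h
    rcases hc j hj j' hj' hne with h1 | h1
    · have := NN_lt (t := σ j) j hj (by omega) h1
      omega
    · have := NN_lt (t := σ j') j' hj' (by omega) h1
      omega
  have himg : S.image (fun j => NN σ p S (σ j)) = Finset.range S.card := by
    apply Finset.eq_of_subset_of_card_le
    · intro x hx
      simp only [Finset.mem_image] at hx
      obtain ⟨j, hj, rfl⟩ := hx
      exact Finset.mem_range.2 (NN_self_lt hp j hj)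
    · rw [Finset.card_image_of_injOn hinj]; simp
  have : n ∈ S.image (fun j => NN σ p S (σ j)) := by rw [himg]; exact Finset.mem_range.2 hn
  simpa using this

end NNlem

def Cmp {J : Type} (σ p : J → ℕ) (j j' : J) : Prop := σ j + p j ≤ σ j' ∨ σ j' + p j' ≤ σ j

structure HH {J : Type} (σ p : J → ℕ)
    (A B c a2 a3 b2 b3 al l1 be l2 g2 g3 d2 d3 : Finset J) : Prop where
  pos : ∀ j, 0 < p j
  fA : ∀ j ∈ A, NN σ p B (σ j) = NN σ p c (σ j) ∧
    NN σ p al (σ j) + NN σ p l1 (σ j) = NN σ p c (σ j) ∧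
    NN σ p al (σ j) = NN σ p b2 (σ j) + NN σ p g2 (σ j) ∧
    NN σ p al (σ j) = NN σ p b3 (σ j) + NN σ p g3 (σ j) ∧
    NN σ p a3 (σ j) = NN σ p b2 (σ j) ∧ NN σ p a2 (σ j) = NN σ p b3 (σ j) ∧
    NN σ p d2 (σ j) = NN σ p b2 (σ j) ∧ NN σ p d3 (σ j) = NN σ p b3 (σ j)
  fB : ∀ j ∈ B, NN σ p A (σ j) = NN σ p c (σ j) ∧
    NN σ p be (σ j) + NN σ p l2 (σ j) = NN σ p c (σ j) ∧
    NN σ p be (σ j) = NN σ p a2 (σ j) + NN σ p d2 (σ j) ∧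
    NN σ p be (σ j) = NN σ p a3 (σ j) + NN σ p d3 (σ j) ∧
    NN σ p b3 (σ j) = NN σ p a2 (σ j) ∧ NN σ p b2 (σ j) = NN σ p a3 (σ j) ∧
    NN σ p g2 (σ j) = NN σ p a2 (σ j) ∧ NN σ p g3 (σ j) = NN σ p a3 (σ j)
  fa2 : ∀ j ∈ a2, NN σ p B (σ j) = NN σ p c (σ j) ∧
    NN σ p al (σ j) + NN σ p l1 (σ j) = NN σ p c (σ j) ∧
    NN σ p al (σ j) = NN σ p b2 (σ j) + NN σ p g2 (σ j) ∧
    NN σ p a3 (σ j) = NN σ p b2 (σ j)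
  fa3 : ∀ j ∈ a3, NN σ p B (σ j) = NN σ p c (σ j) ∧
    NN σ p al (σ j) + NN σ p l1 (σ j) = NN σ p c (σ j) ∧
    NN σ p al (σ j) = NN σ p b3 (σ j) + NN σ p g3 (σ j) ∧
    NN σ p a2 (σ j) = NN σ p b3 (σ j)
  fb2 : ∀ j ∈ b2, NN σ p A (σ j) = NN σ p c (σ j) ∧
    NN σ p be (σ j) + NN σ p l2 (σ j) = NN σ p c (σ j) ∧
    NN σ p be (σ j) = NN σ p a2 (σ j) + NN σ p d2 (σ j) ∧
    NN σ p b3 (σ j) = NN σ p a2 (σ j)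
  fb3 : ∀ j ∈ b3, NN σ p A (σ j) = NN σ p c (σ j) ∧
    NN σ p be (σ j) + NN σ p l2 (σ j) = NN σ p c (σ j) ∧
    NN σ p be (σ j) = NN σ p a3 (σ j) + NN σ p d3 (σ j) ∧
    NN σ p b2 (σ j) = NN σ p a3 (σ j)
  fc : ∀ j ∈ c, NN σ p a2 (σ j) + NN σ p b2 (σ j) = NN σ p a3 (σ j) + NN σ p b3 (σ j)
  cAA : ∀ j ∈ A, ∀ j' ∈ A, j ≠ j' → Cmp σ p j j'
  cBB : ∀ j ∈ B, ∀ j' ∈ B, j ≠ j' → Cmp σ p j j'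
  ccc : ∀ j ∈ c, ∀ j' ∈ c, j ≠ j' → Cmp σ p j j'
  cA : ∀ j ∈ A, ∀ x, (x ∈ a2 ∨ x ∈ a3 ∨ x ∈ b2 ∨ x ∈ b3 ∨ x ∈ c ∨ x ∈ B) → Cmp σ p j x
  cB : ∀ j ∈ B, ∀ x, (x ∈ a2 ∨ x ∈ a3 ∨ x ∈ b2 ∨ x ∈ b3 ∨ x ∈ c ∨ x ∈ A) → Cmp σ p j x
  cc : ∀ j ∈ c, ∀ x, (x ∈ a2 ∨ x ∈ a3 ∨ x ∈ b2 ∨ x ∈ b3) → Cmp σ p j x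
  caa : ∀ x ∈ a2, ∀ y ∈ a3, Cmp σ p x y
  cbb : ∀ x ∈ b2, ∀ y ∈ b3, Cmp σ p x y

section HHlem
variable {J : Type} {σ p : J → ℕ} {A B c a2 a3 b2 b3 al l1 be l2 g2 g3 d2 d3 : Finset J}

theorem HH.swap (h : HH σ p A B c a2 a3 b2 b3 al l1 be l2 g2 g3 d2 d3) :
    HH σ p B A c b2 b3 a2 a3 be l2 al l1 d2 d3 g2 g3 where
  pos := h.pos
  fA := h.fB
  fB := h.fA
  fa2 := h.fb2
  fa3 := h.fb3
  fb2 := h.fa2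
  fb3 := h.fa3
  fc := fun j hj => by have := h.fc j hj; omega
  cAA := h.cBB
  cBB := h.cAA
  ccc := h.ccc
  cA := fun j hj x hx => h.cB j hj x (by tauto)
  cB := fun j hj x hx => h.cA j hj x (by tauto)
  cc := fun j hj x hx => h.cc j hj x (by tauto)
  caa := h.cbb
  cbb := h.caa

/-- two A-jobs on the same `c` level see the same counts -/
theorem HH.same (h : HH σ p A B c a2 a3 b2 b3 al l1 be l2 g2 g3 d2 d3)
    (j0 j1 : J) (h0 : j0 ∈ A) (h1 : j1 ∈ A) (hle : σ j0 ≤ σ j1)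
    (hc : NN σ p c (σ j0) = NN σ p c (σ j1)) :
    NN σ p a2 (σ j0) = NN σ p a2 (σ j1) ∧ NN σ p a3 (σ j0) = NN σ p a3 (σ j1) := by
  have e0 := h.fA j0 h0
  have e1 := h.fA j1 h1
  have := NN_mono (σ := σ) (p := p) (S := al) hle
  have := NN_mono (σ := σ) (p := p) (S := l1) hle
  have := NN_mono (σ := σ) (p := p) (S := b2) hle
  have := NN_mono (σ := σ) (p := p) (S := g2) hle
  have := NN_mono (σ := σ) (p := p) (S := b3) hle
  have := NN_mono (σ := σ) (p := p) (S := g3) hle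
  omega

theorem HH.single (h : HH σ p A B c a2 a3 b2 b3 al l1 be l2 g2 g3 d2 d3)
    (j0 : J) (h0 : j0 ∈ A) (t : ℕ) (hc : NN σ p c t = NN σ p c (σ j0))
    (h2 : NN σ p a2 (σ j0) < NN σ p a2 t) (h3 : NN σ p a3 (σ j0) < NN σ p a3 t) : False := by
  obtain ⟨x, hx, hx1, hx2⟩ := NN_ex h2
  obtain ⟨y, hy, hy1, hy2⟩ := NN_ex h3
  have e0 := h.fA j0 h0
  have hxs : σ j0 ≤ σ x := by
    rcases h.cA j0 h0 x (by tauto) with h' | h' <;> omega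
  have hys : σ j0 ≤ σ y := by
    rcases h.cA j0 h0 y (by tauto) with h' | h' <;> omega
  have px := h.pos x
  have py := h.pos y
  rcases h.caa x hx y hy with h' | h'
  · have e := h.fa3 y hy
    have := NN_mono (σ := σ) (p := p) (S := c) hys
    have := NN_mono (σ := σ) (p := p) (S := c) (show σ y ≤ t by omega)
    have := NN_mono (σ := σ) (p := p) (S := al) hys
    have := NN_mono (σ := σ) (p := p) (S := l1) hys
    have := NN_mono (σ := σ) (p := p) (S := b3) hys
    have := NN_mono (σ := σ) (p := p) (S := g3) hys
    have := NN_lt x hx hx1 h'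
    omega
  · have e := h.fa2 x hx
    have := NN_mono (σ := σ) (p := p) (S := c) hxs
    have := NN_mono (σ := σ) (p := p) (S := c) (show σ x ≤ t by omega)
    have := NN_mono (σ := σ) (p := p) (S := al) hxs
    have := NN_mono (σ := σ) (p := p) (S := l1) hxs
    have := NN_mono (σ := σ) (p := p) (S := b2) hxs
    have := NN_mono (σ := σ) (p := p) (S := g2) hxs
    have := NN_lt y hy hy1 h'
    omega

theorem HH.noab (h : HH σ p A B c a2 a3 b2 b3 al l1 be l2 g2 g3 d2 d3)
    (j0 j1 : J) (h0 : j0 ∈ A) (h1 : j1 ∈ B) (hle : σ j0 + p j0 ≤ σ j1)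
    (hB : NN σ p B (σ j0) = NN σ p B (σ j1)) (hcl : NN σ p B (σ j0) < NN σ p c (σ j1)) :
    NN σ p a2 (σ j0) = NN σ p a2 (σ j1) ∧ NN σ p a3 (σ j0) = NN σ p a3 (σ j1) := by
  have hp0 := h.pos j0
  have hA0 := NN_lt j0 h0 (t := σ j0) (by omega) hle
  -- last A job before j1
  obtain ⟨j', hj', hr⟩ := NN_rank (S := A) h.pos h.cAA (NN σ p A (σ j1) - 1)
    (by have := NN_le_card (σ := σ) (p := p) (S := A) (t := σ j1); omega)
  have hpj' := h.pos j'
  have hj'1 : σ j' + p j' ≤ σ j1 := by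
    rcases h.cB j1 h1 j' (by tauto) with h' | h'
    · have := NN_mono (σ := σ) (p := p) (S := A) (show σ j1 ≤ σ j' by omega)
      omega
    · exact h'
  have hj0' : σ j0 ≤ σ j' := by
    by_contra hcon
    have hne : j' ≠ j0 := by rintro rfl; omega
    rcases h.cAA j' hj' j0 h0 hne with h' | h'
    · have := NN_lt j' hj' (t := σ j') (by omega) h'
      omega
    · omega
  have eq0 := h.fA j0 h0
  have eq' := h.fA j' hj'
  have eq1 := h.fB j1 h1
  have hB1 := NN_mono (σ := σ) (p := p) (S := B) hj0'
  have hB2 := NN_mono (σ := σ) (p := p) (S := B) (show σ j' ≤ σ j1 by omega)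
  obtain ⟨s2, s3⟩ := h.same j0 j' h0 hj' hj0' (by omega)
  -- first c after
  obtain ⟨q, hq, hqr⟩ := NN_rank (S := c) h.pos h.ccc (NN σ p B (σ j0))
    (by have := NN_le_card (σ := σ) (p := p) (S := c) (t := σ j1); omega)
  have hpq := h.pos q
  have hq' : σ j' + p j' ≤ σ q := by
    rcases h.cA j' hj' q (by tauto) with h' | h'
    · exact h'
    · have := NN_lt q hq (t := σ q) (by omega) h'
      omega
  have hq1 : σ q + p q ≤ σ j1 := by
    rcases h.cB j1 h1 q (by tauto) with h' | h'
    · have := NN_mono (σ := σ) (p := p) (S := c) (show σ j1 ≤ σ q by omega)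
      omega
    · exact h'
  have ha : ∀ x, (x ∈ a2 ∨ x ∈ a3) → σ x + p x ≤ σ j1 → σ x + p x ≤ σ q := by
    intro x hx hx1
    rcases h.cc q hq x (by tauto) with h' | h'
    · have hpx := h.pos x
      have hBx : NN σ p B (σ x) = NN σ p c (σ x) := by
        rcases hx with hx | hx
        · exact (h.fa2 x hx).1
        · exact (h.fa3 x hx).1
      have := NN_mono (σ := σ) (p := p) (S := B) (show σ x ≤ σ j1 by omega)
      have := NN_lt q hq (t := σ q) (by omega) h'
      omega
    · exact h'
  have hb : ∀ x, (x ∈ b2 ∨ x ∈ b3) → σ x + p x ≤ σ q → σ x + p x ≤ σ j' := by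
    intro x hx hx1
    rcases h.cA j' hj' x (by tauto) with h' | h'
    · have hpx := h.pos x
      have hAx : NN σ p A (σ x) = NN σ p c (σ x) := by
        rcases hx with hx | hx
        · exact (h.fb2 x hx).1
        · exact (h.fb3 x hx).1
      have := NN_lt j' hj' (t := σ j') (by omega) h'
      have := NN_mono (σ := σ) (p := p) (S := c) (show σ x ≤ σ q by omega)
      omega
    · exact h'
  have hq'le : σ j' ≤ σ q := by omega
  have hq1le : σ q ≤ σ j1 := by omega
  have a2e : NN σ p a2 (σ q) = NN σ p a2 (σ j1) := by
    by_contra hne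
    obtain ⟨x, hx, hx1, hx2⟩ := NN_ex (lt_of_le_of_ne (NN_mono hq1le) hne)
    have := ha x (by tauto) hx2
    omega
  have a3e : NN σ p a3 (σ q) = NN σ p a3 (σ j1) := by
    by_contra hne
    obtain ⟨x, hx, hx1, hx2⟩ := NN_ex (lt_of_le_of_ne (NN_mono hq1le) hne)
    have := ha x (by tauto) hx2
    omega
  have b2e : NN σ p b2 (σ j') = NN σ p b2 (σ q) := by
    by_contra hne
    obtain ⟨x, hx, hx1, hx2⟩ := NN_ex (lt_of_le_of_ne (NN_mono hq'le) hne)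
    have := hb x (by tauto) hx2
    omega
  have b3e : NN σ p b3 (σ j') = NN σ p b3 (σ q) := by
    by_contra hne
    obtain ⟨x, hx, hx1, hx2⟩ := NN_ex (lt_of_le_of_ne (NN_mono hq'le) hne)
    have := hb x (by tauto) hx2
    omega
  have eqq := h.fc q hq
  have m2 := NN_mono (σ := σ) (p := p) (S := a2) hq'le
  have m3 := NN_mono (σ := σ) (p := p) (S := a3) hq'le
  have sg := h.single j' hj' (σ q) (by omega)
  by_cases hh : NN σ p a2 (σ j') < NN σ p a2 (σ q)
  · exact (sg hh (by omega)).elim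
  · omega

theorem HH.step (h : HH σ p A B c a2 a3 b2 b3 al l1 be l2 g2 g3 d2 d3) (z n : ℕ)
    (cdA : A.card = z + 1) (cdB : B.card = z + 1)
    (cl1 : l1.card = 1) (cl2 : l2.card = 1)
    (cg : g2.card + g3.card = z) (cd : d2.card + d3.card = z)
    (K1 : ∀ j0 ∈ A, ∀ j1 ∈ B, σ j0 ≤ σ j1 → NN σ p c (σ j0) = NN σ p c (σ j1) →
      1 ≤ NN σ p c (σ j0) → NN σ p c (σ j0) ≤ z → NN σ p l2 (σ j1) = 0 ∧ NN σ p l1 (σ j0) = 1)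
    (K2 : ∀ j0 ∈ B, ∀ j1 ∈ A, σ j0 ≤ σ j1 → NN σ p c (σ j0) = NN σ p c (σ j1) →
      1 ≤ NN σ p c (σ j0) → NN σ p c (σ j0) ≤ z → NN σ p l1 (σ j1) = 0)
    (cal : al.card = z) (cbe : be.card = z)
    (B0 : J) (hB0 : B0 ∈ B) (hB0A : NN σ p A (σ B0) = n) (hB0B : NN σ p B (σ B0) = n)
    (hB0a : NN σ p a2 (σ B0) + NN σ p a3 (σ B0) ≤ n)
    (A0 : J) (hA0 : A0 ∈ A) (hA0A : NN σ p A (σ A0) = n) :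
    NN σ p B (σ A0) = n + 1 ∧ NN σ p l1 (σ A0) = 1 ∧
    (n + 1 ≤ z → ∃ B1 ∈ B, NN σ p A (σ B1) = n + 1 ∧ NN σ p B (σ B1) = n + 1 ∧
      NN σ p a2 (σ B1) + NN σ p a3 (σ B1) ≤ n + 1) := by
  have pB0 := h.pos B0
  have pA0 := h.pos A0
  have hBA : σ B0 + p B0 ≤ σ A0 := by
    rcases h.cB B0 hB0 A0 (by tauto) with h' | h'
    · exact h'
    · have := NN_lt A0 hA0 (t := σ A0) (by omega) h'
      omega
  have fB0 := h.fB B0 hB0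
  have fA0 := h.fA A0 hA0
  have hm := NN_lt B0 hB0 (t := σ B0) (by omega) hBA
  have hn1 := h.swap.noab B0 A0 hB0 hA0 hBA (by omega) (by omega)
  have L1 := NN_le_card (σ := σ) (p := p) (S := l1) (t := σ A0)
  have L2 := NN_le_card (σ := σ) (p := p) (S := al) (t := σ A0)
  have L3 := NN_le_card (σ := σ) (p := p) (S := g2) (t := σ A0)
  have L4 := NN_le_card (σ := σ) (p := p) (S := g3) (t := σ A0)
  have L5 := NN_le_card (σ := σ) (p := p) (S := B) (t := σ A0)
  by_cases hmz : NN σ p B (σ A0) = z + 1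
  · refine ⟨by omega, by omega, fun _ => by omega⟩
  obtain ⟨B1, hB1, hB1r⟩ := NN_rank (S := B) h.pos h.cBB (NN σ p B (σ A0)) (by omega)
  have pB1 := h.pos B1
  have hAB : σ A0 + p A0 ≤ σ B1 := by
    rcases h.cA A0 hA0 B1 (by tauto) with h' | h'
    · exact h'
    · have := NN_lt B1 hB1 (t := σ B1) (by omega) h'
      omega
  have hABle : σ A0 ≤ σ B1 := by omega
  have fB1 := h.fB B1 hB1
  have hmm := NN_mono (σ := σ) (p := p) (S := c) hABle
  have G2 := NN_mono (σ := σ) (p := p) (S := g2) hABle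
  have G3 := NN_mono (σ := σ) (p := p) (S := g3) hABle
  have D2 := NN_mono (σ := σ) (p := p) (S := d2) hABle
  have D3 := NN_mono (σ := σ) (p := p) (S := d3) hABle
  by_cases hmc : NN σ p c (σ A0) = NN σ p c (σ B1)
  · obtain ⟨k1, k2⟩ := K1 A0 hA0 B1 hB1 hABle hmc (by omega) (by omega)
    have sg := h.single A0 hA0 (σ B1) hmc.symm
    have hns : ¬ (NN σ p a2 (σ A0) < NN σ p a2 (σ B1) ∧ NN σ p a3 (σ A0) < NN σ p a3 (σ B1)) :=
      fun hh => sg hh.1 hh.2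
    refine ⟨by omega, k2, fun _ => ⟨B1, hB1, by omega, by omega, by omega⟩⟩
  · exfalso
    have hn2 := h.noab A0 B1 hA0 hB1 hAB (by omega) (by omega)
    have M1 := NN_le_card (σ := σ) (p := p) (S := l2) (t := σ B1)
    have M2 := NN_le_card (σ := σ) (p := p) (S := be) (t := σ B1)
    have M3 := NN_le_card (σ := σ) (p := p) (S := d2) (t := σ B1)
    have M4 := NN_le_card (σ := σ) (p := p) (S := d3) (t := σ B1)
    have M5 := NN_le_card (σ := σ) (p := p) (S := A) (t := σ B1)
    have hmz1 : NN σ p A (σ B1) ≤ z := by omega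
    obtain ⟨A1, hA1, hA1r⟩ := NN_rank (S := A) h.pos h.cAA (NN σ p A (σ B1)) (by omega)
    have pA1 := h.pos A1
    have hBA1 : σ B1 + p B1 ≤ σ A1 := by
      rcases h.cB B1 hB1 A1 (by tauto) with h' | h'
      · exact h'
      · have := NN_lt A1 hA1 (t := σ A1) (by omega) h'
        omega
    have hBA1le : σ B1 ≤ σ A1 := by omega
    have fA1 := h.fA A1 hA1
    have N1 := NN_mono (σ := σ) (p := p) (S := l1) (show σ A0 ≤ σ A1 by omega)
    have N2 := NN_mono (σ := σ) (p := p) (S := c) hBA1le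
    have N3 := NN_mono (σ := σ) (p := p) (S := d2) hBA1le
    have N4 := NN_mono (σ := σ) (p := p) (S := d3) hBA1le
    have N5 := NN_le_card (σ := σ) (p := p) (S := l1) (t := σ A1)
    by_cases hmc1 : NN σ p c (σ B1) = NN σ p c (σ A1)
    · have := K2 B1 hB1 A1 hA1 hBA1le hmc1 (by omega) (by omega)
      omega
    · have hn3 := h.swap.noab B1 A1 hB1 hA1 hBA1 (by omega) (by omega)
      omega

end HHlem

theorem sum_job {z : ℕ} {R : Type} [AddCommMonoid R] (f : Job z → R) :
    ∑ j, f j = (∑ i, f (.JA i)) + ((∑ i, f (.JB i)) + ((∑ i, f (.Ja i)) + ((∑ i, f (.Jb i)) +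
      ((∑ i, f (.Jc i)) + ((∑ i, f (.Jα i)) + ((∑ i, f (.Jβ i)) + ((∑ i, f (.Jγ i)) +
      ((∑ i, f (.Jδ i)) + (f .Jl1 + (f .Jl2 + ∑ i, f (.Jpart i))))))))))) := by
  let e : Job z ≃ (Fin (z+1) ⊕ Fin (z+1) ⊕ Fin z ⊕ Fin z ⊕ Fin (z+1) ⊕ Fin z ⊕ Fin z ⊕ Fin z ⊕
      Fin z ⊕ Unit ⊕ Unit ⊕ Fin (3*z)) :=
    { toFun := fun j => match j with
        | .JA i => .inl i
        | .JB i => .inr (.inl i)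
        | .Ja i => .inr (.inr (.inl i))
        | .Jb i => .inr (.inr (.inr (.inl i)))
        | .Jc i => .inr (.inr (.inr (.inr (.inl i))))
        | .Jα i => .inr (.inr (.inr (.inr (.inr (.inl i)))))
        | .Jβ i => .inr (.inr (.inr (.inr (.inr (.inr (.inl i))))))
        | .Jγ i => .inr (.inr (.inr (.inr (.inr (.inr (.inr (.inl i)))))))
        | .Jδ i => .inr (.inr (.inr (.inr (.inr (.inr (.inr (.inr (.inl i))))))))
        | .Jl1 => .inr (.inr (.inr (.inr (.inr (.inr (.inr (.inr (.inr (.inl ())))))))))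
        | .Jl2 => .inr (.inr (.inr (.inr (.inr (.inr (.inr (.inr (.inr (.inr (.inl ()))))))))))
        | .Jpart i => .inr (.inr (.inr (.inr (.inr (.inr (.inr (.inr (.inr (.inr (.inr i))))))))))
      invFun := Sum.elim .JA <| Sum.elim .JB <| Sum.elim .Ja <| Sum.elim .Jb <| Sum.elim .Jc <|
        Sum.elim .Jα <| Sum.elim .Jβ <| Sum.elim .Jγ <| Sum.elim .Jδ <|
        Sum.elim (fun _ => .Jl1) <| Sum.elim (fun _ => .Jl2) .Jpart
      left_inv := by intro j; cases j <;> rfl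
      right_inv := by
        rintro (i|i|i|i|i|i|i|i|i|i|i|i) <;> rfl }
  rw [← Equiv.sum_comp e.symm]
  simp only [Fintype.sum_sum_type]
  simp [e]

section TTlem
variable {J : Type} [Fintype J]

def TT (σ p : J → ℕ) (f : J → ℤ) (t : ℕ) : ℤ := ∑ j, if σ j + p j ≤ t then f j else 0

variable {σ p : J → ℕ}

theorem TT_add (f g : J → ℤ) (t : ℕ) :
    TT σ p f t + TT σ p g t = TT σ p (fun j => f j + g j) t := by
  unfold TT
  rw [← Finset.sum_add_distrib]
  apply Finset.sum_congr rfl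
  intro j _
  split_ifs <;> simp

theorem TT_sub (f g : J → ℤ) (t : ℕ) :
    TT σ p f t - TT σ p g t = TT σ p (fun j => f j - g j) t := by
  unfold TT
  rw [← Finset.sum_sub_distrib]
  apply Finset.sum_congr rfl
  intro j _
  split_ifs <;> simp

theorem TT_mul (a : ℤ) (f : J → ℤ) (t : ℕ) :
    a * TT σ p f t = TT σ p (fun j => a * f j) t := by
  unfold TT
  rw [Finset.mul_sum]
  apply Finset.sum_congr rfl
  intro j _
  split_ifs <;> simp

theorem TT_NN [DecidableEq J] (S : Finset J) (t : ℕ) :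
    (NN σ p S t : ℤ) = TT σ p (fun j => if j ∈ S then 1 else 0) t := by
  unfold TT NN
  rw [Finset.card_filter]
  push_cast
  rw [← Finset.sum_filter_add_sum_filter_not Finset.univ (fun j => j ∈ S)]
  rw [Finset.sum_eq_zero (s := Finset.univ.filter (fun j => ¬ j ∈ S))]
  · simp only [add_zero]
    have : Finset.univ.filter (fun j => j ∈ S) = S := by ext; simp
    rw [this]
    apply Finset.sum_congr rfl
    intro j hj
    simp [hj]
  · intro j hj
    simp at hj
    simp [hj]

theorem TT_nonneg (f : J → ℤ) (hf : ∀ j, 0 ≤ f j) (t : ℕ) : 0 ≤ TT σ p f t := by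
  apply Finset.sum_nonneg
  intro j _
  split_ifs
  · exact hf j
  · exact le_rfl

theorem TT_le (f : J → ℤ) (hf : ∀ j, 0 ≤ f j) (t : ℕ) : TT σ p f t ≤ ∑ j, f j := by
  apply Finset.sum_le_sum
  intro j _
  split_ifs
  · exact le_rfl
  · exact hf j

theorem TT_mono (f : J → ℤ) (hf : ∀ j, 0 ≤ f j) {t t' : ℕ} (h : t ≤ t') :
    TT σ p f t ≤ TT σ p f t' := by
  apply Finset.sum_le_sum
  intro j _
  have := hf j
  split_ifs
  · exact le_rfl
  · omega
  · exact hf j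
  · exact le_rfl

theorem TT_same (f : J → ℤ) (S S' : Finset J) (hf : ∀ j, f j ≠ 0 → j ∈ S ∨ j ∈ S') {t t' : ℕ}
    (h : t ≤ t') (hS : NN σ p S t = NN σ p S t') (hS' : NN σ p S' t = NN σ p S' t') :
    TT σ p f t = TT σ p f t' := by
  apply Finset.sum_congr rfl
  intro j _
  by_cases h0 : f j = 0
  · simp [h0]
  · by_cases h1 : σ j + p j ≤ t
    · simp [h1, h1.trans h]
    · by_cases h2 : σ j + p j ≤ t'
      · exfalso
        rcases hf j h0 with hj | hj
        · have := NN_lt (σ := σ) (p := p) (t := t) j hj (by omega) h2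
          omega
        · have := NN_lt (σ := σ) (p := p) (t := t) j hj (by omega) h2
          omega
      · simp [h1, h2]

end TTlem

def k2 {z : ℕ} : Job z → ℤ
  | .JA _ => 1 | .Jβ _ => 1 | .Jl2 => 1 | _ => 0
def k3 {z : ℕ} : Job z → ℤ
  | .JB _ => 1 | .Jα _ => 1 | .Jl1 => 1 | _ => 0
def k4 {z : ℕ} : Job z → ℤ
  | .Ja _ => 1 | .Jβ _ => 1 | .Jδ _ => 1 | _ => 0
def k5 {z : ℕ} : Job z → ℤ
  | .Jb _ => 1 | .Jα _ => 1 | .Jγ _ => 1 | _ => 0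
def k6 {z : ℕ} : Job z → ℤ
  | .Ja _ => 1 | .Jb _ => 1 | _ => 0
def k7 {z : ℕ} : Job z → ℤ
  | .Ja _ => 3*z | .Jb _ => 3*z | .Jc j => z + (j.val : ℤ) | .Jα _ => 4*z | .Jβ _ => 4*z-1
  | .Jγ j => 3*z - ((j.val : ℤ)+1) | .Jδ j => 3*z - ((j.val : ℤ)+1) | .Jl1 => z | .Jl2 => 2*z | _ => 0
def k8 {z : ℕ} : Job z → ℤ
  | .Jc _ => 1 | .Jα _ => 1 | .Jβ _ => 1 | .Jl1 => 1 | .Jl2 => 1 | _ => 0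
def kp {z : ℕ} (ι : Fin (3*z) → ℕ) : Job z → ℤ
  | .Jpart i => ι i | _ => 0
def kg {z : ℕ} : Job z → ℤ
  | .Jγ _ => 1 | _ => 0
def wgd {z : ℕ} : Job z → ℤ
  | .Jγ j => (j.val : ℤ)+1 | .Jδ j => (j.val : ℤ)+1 | _ => 0
def wc {z : ℕ} : Job z → ℤ
  | .Jc j => (j.val : ℤ) | _ => 0

theorem p_dig (z D : ℕ) (ι : Fin (3*z) → ℕ) (hD : 0 < D) (hz : 0 < z) (j : Job z) :
    (pJob z D ι j : ℤ) = kp ι j - D * kg j + D^2 * k2 j + D^3 * k3 j + D^4 * k4 j + D^5 * k5 j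
      + D^6 * k6 j + D^7 * k7 j + D^8 * k8 j := by
  cases j with
  | Jγ j =>
    have h1 : D ≤ D^5 + (3*z - (j.val+1))*D^7 := by
      have : D ≤ D^5 := Nat.le_self_pow (by norm_num) D
      have := Nat.zero_le ((3*z - (j.val+1))*D^7)
      omega
    have h2 : j.val + 1 ≤ 3*z := by have := j.2; omega
    simp only [pJob, kp, kg, k2, k3, k4, k5, k6, k7, k8]
    push_cast [Nat.cast_sub h1, Nat.cast_sub h2]
    ring
  | Jδ j =>
    have h2 : j.val + 1 ≤ 3*z := by have := j.2; omega
    simp only [pJob, kp, kg, k2, k3, k4, k5, k6, k7, k8]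
    push_cast [Nat.cast_sub h2]
    ring
  | Jβ j =>
    have h2 : 1 ≤ 4*z := by omega
    simp only [pJob, kp, kg, k2, k3, k4, k5, k6, k7, k8]
    push_cast [Nat.cast_sub h2]
    ring
  | _ =>
    simp only [pJob, kp, kg, k2, k3, k4, k5, k6, k7, k8]
    push_cast
    ring

theorem dig0 (D r q : ℤ) (h : r + D * q = 0) (h1 : r < D) (h2 : -D < r) : r = 0 ∧ q = 0 := by
  have hD : 0 < D := by linarith
  have hq : q = 0 := by
    rcases lt_trichotomy q 0 with h' | h' | h'
    · nlinarith
    · exact h'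
    · nlinarith
  subst hq
  simp at h
  exact ⟨h, rfl⟩

theorem dig_all (D r d2 d3 d4 d5 d6 d7 d8 : ℤ)
    (h : r + D^2*d2 + D^3*d3 + D^4*d4 + D^5*d5 + D^6*d6 + D^7*d7 + D^8*d8 = 0)
    (hr : |r| < D^2) (h2 : |d2| < D) (h3 : |d3| < D) (h4 : |d4| < D) (h5 : |d5| < D)
    (h6 : |d6| < D) (h7 : |d7| < D) :
    d2 = 0 ∧ d3 = 0 ∧ d4 = 0 ∧ d5 = 0 ∧ d6 = 0 ∧ d7 = 0 ∧ d8 = 0 := by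
  rw [abs_lt] at *
  obtain ⟨e1, s1⟩ := dig0 (D^2) r (d2 + D*(d3 + D*(d4 + D*(d5+D*(d6+D*(d7+D*d8))))))
    (by linear_combination h) hr.2 hr.1
  obtain ⟨e2, s2⟩ := dig0 D _ _ s1 h2.2 h2.1
  obtain ⟨e3, s3⟩ := dig0 D _ _ s2 h3.2 h3.1
  obtain ⟨e4, s4⟩ := dig0 D _ _ s3 h4.2 h4.1
  obtain ⟨e5, s5⟩ := dig0 D _ _ s4 h5.2 h5.1
  obtain ⟨e6, s6⟩ := dig0 D _ _ s5 h6.2 h6.1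
  obtain ⟨e7, s7⟩ := dig0 D _ _ s6 h7.2 h7.1
  exact ⟨e2, e3, e4, e5, e6, e7, s7⟩

def mi {z : ℕ} (ρ : Job z → Finset ℕ) (M : ℕ) (f : Job z → ℤ) (j : Job z) : ℤ :=
  if M ∈ ρ j then f j else 0

theorem mi_bd {z : ℕ} {σ p : Job z → ℕ} (ρ : Job z → Finset ℕ) (M : ℕ) (f : Job z → ℤ) (t : ℕ)
    (hf : ∀ j, 0 ≤ f j) (K : ℤ) (hK : ∑ j, f j ≤ K) :
    0 ≤ TT σ p (mi ρ M f) t ∧ TT σ p (mi ρ M f) t ≤ K := by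
  have h0 : ∀ j, 0 ≤ mi ρ M f j := by
    intro j; unfold mi; split_ifs
    · exact hf j
    · exact le_rfl
  refine ⟨TT_nonneg _ h0 t, ((TT_le _ h0 t).trans ?_).trans hK⟩
  apply Finset.sum_le_sum
  intro j _
  have := hf j
  unfold mi; split_ifs
  · exact le_rfl
  · exact this

theorem mach_eq (z D : ℕ) (ι : Fin (3*z) → ℕ) (hz : 0 < z) (hDpos : 0 < D)
    (σ : Job z → ℕ) (ρ : Job z → Finset ℕ)
    (hfeas : Feasible 4 (pJob z D ι) (qJob z) σ ρ) (W : ℕ)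
    (hW : ∀ j, σ j + pJob z D ι j ≤ W) (M : ℕ)
    (htot : ∑ j with M ∈ ρ j, pJob z D ι j = W) (i : Job z) (hi : M ∈ ρ i) :
    (σ i : ℤ) = TT σ (pJob z D ι) (mi ρ M (kp ι)) (σ i) - D * TT σ (pJob z D ι) (mi ρ M kg) (σ i)
      + D^2 * TT σ (pJob z D ι) (mi ρ M k2) (σ i) + D^3 * TT σ (pJob z D ι) (mi ρ M k3) (σ i)
      + D^4 * TT σ (pJob z D ι) (mi ρ M k4) (σ i) + D^5 * TT σ (pJob z D ι) (mi ρ M k5) (σ i)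
      + D^6 * TT σ (pJob z D ι) (mi ρ M k6) (σ i) + D^7 * TT σ (pJob z D ι) (mi ρ M k7) (σ i)
      + D^8 * TT σ (pJob z D ι) (mi ρ M k8) (σ i) := by
  have h := pk_start_eq σ (pJob z D ι) (Finset.univ.filter (fun j => M ∈ ρ j)) W
    (fun j hj j' hj' hne => hfeas.2.2 j j' hne ⟨M, by
      simp only [Finset.mem_filter, Finset.mem_univ, true_and] at hj hj'
      exact Finset.mem_inter.2 ⟨hj, hj'⟩⟩) (fun j _ => hW j) htot i (by simp [hi])
  have h' : (σ i : ℤ) = TT σ (pJob z D ι) (mi ρ M (fun j => (pJob z D ι j : ℤ))) (σ i) := by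
    conv_lhs => rw [← h]
    push_cast
    rw [Finset.filter_filter, Finset.sum_filter]
    apply Finset.sum_congr rfl
    intro j _
    unfold mi
    split_ifs <;> first | rfl | (exfalso; tauto)
  rw [h']
  simp only [TT_mul, TT_sub, TT_add]
  congr 1
  funext j
  unfold mi
  split_ifs
  · exact p_dig z D ι hDpos hz j
  · simp

set_option maxHeartbeats 1000000 in
theorem dig_eq (z D : ℕ) (ι : Fin (3*z) → ℕ) (hz : 0 < z) (hDpos : 0 < D)
    (hsum : ∑ i, ι i = z * D) (hD : 4*z*(7*z+1) < D)
    (σ : Job z → ℕ) (ρ : Job z → Finset ℕ)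
    (hfeas : Feasible 4 (pJob z D ι) (qJob z) σ ρ) (W : ℕ)
    (hW : ∀ j, σ j + pJob z D ι j ≤ W) (M M' : ℕ)
    (htot : ∑ j with M ∈ ρ j, pJob z D ι j = W)
    (htot' : ∑ j with M' ∈ ρ j, pJob z D ι j = W) (i : Job z) (hi : M ∈ ρ i) (hi' : M' ∈ ρ i) :
    TT σ (pJob z D ι) (mi ρ M k2) (σ i) = TT σ (pJob z D ι) (mi ρ M' k2) (σ i) ∧
    TT σ (pJob z D ι) (mi ρ M k3) (σ i) = TT σ (pJob z D ι) (mi ρ M' k3) (σ i) ∧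
    TT σ (pJob z D ι) (mi ρ M k4) (σ i) = TT σ (pJob z D ι) (mi ρ M' k4) (σ i) ∧
    TT σ (pJob z D ι) (mi ρ M k5) (σ i) = TT σ (pJob z D ι) (mi ρ M' k5) (σ i) ∧
    TT σ (pJob z D ι) (mi ρ M k6) (σ i) = TT σ (pJob z D ι) (mi ρ M' k6) (σ i) ∧
    TT σ (pJob z D ι) (mi ρ M k7) (σ i) = TT σ (pJob z D ι) (mi ρ M' k7) (σ i) ∧
    TT σ (pJob z D ι) (mi ρ M k8) (σ i) = TT σ (pJob z D ι) (mi ρ M' k8) (σ i) := by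
  have e := mach_eq z D ι hz hDpos σ ρ hfeas W hW M htot i hi
  have e' := mach_eq z D ι hz hDpos σ ρ hfeas W hW M' htot' i hi'
  have hDz : 4*(z:ℤ)*(7*z+1) < D := by exact_mod_cast hD
  have hz1 : (1:ℤ) ≤ z := by exact_mod_cast hz
  have hzz : (z:ℤ) ≤ z*z := by nlinarith
  have B := fun (M : ℕ) f hf K hK => mi_bd (σ := σ) (p := pJob z D ι) ρ M f (σ i) hf K hK
  have n2 : ∀ j : Job z, 0 ≤ k2 j := by intro j; cases j <;> simp [k2]
  have n3 : ∀ j : Job z, 0 ≤ k3 j := by intro j; cases j <;> simp [k3]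
  have n4 : ∀ j : Job z, 0 ≤ k4 j := by intro j; cases j <;> simp [k4]
  have n5 : ∀ j : Job z, 0 ≤ k5 j := by intro j; cases j <;> simp [k5]
  have n6 : ∀ j : Job z, 0 ≤ k6 j := by intro j; cases j <;> simp [k6]
  have n7 : ∀ j : Job z, 0 ≤ k7 j := by
    intro j; cases j <;> simp [k7] <;> omega
  have np : ∀ j : Job z, 0 ≤ kp ι j := by intro j; cases j <;> simp [kp]
  have ng : ∀ j : Job z, 0 ≤ kg j := by intro j; cases j <;> simp [kg]
  have s2 : ∑ j : Job z, k2 j ≤ 2*z+2 := by rw [sum_job]; simp [k2]; linarith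
  have s3 : ∑ j : Job z, k3 j ≤ 2*z+2 := by rw [sum_job]; simp [k3]; linarith
  have s4 : ∑ j : Job z, k4 j ≤ 3*z := by rw [sum_job]; simp [k4]; linarith
  have s5 : ∑ j : Job z, k5 j ≤ 3*z := by rw [sum_job]; simp [k5]; linarith
  have s6 : ∑ j : Job z, k6 j ≤ 2*z := by rw [sum_job]; simp [k6]; linarith
  have s7 : ∑ j : Job z, k7 j ≤ 28*z*z+4*z := by
    rw [sum_job]
    have c1 : ∑ i : Fin (z+1), k7 (Job.Jc i : Job z) ≤ ∑ i : Fin (z+1), 2*(z:ℤ) := by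
      apply Finset.sum_le_sum
      intro i _
      have := i.2
      simp only [k7]; omega
    have c2 : ∑ i : Fin z, k7 (Job.Jγ i : Job z) ≤ ∑ i : Fin z, 3*(z:ℤ) := by
      apply Finset.sum_le_sum
      intro i _
      simp only [k7]; omega
    have c3 : ∑ i : Fin z, k7 (Job.Jδ i : Job z) ≤ ∑ i : Fin z, 3*(z:ℤ) := by
      apply Finset.sum_le_sum
      intro i _
      simp only [k7]; omega
    simp only [Finset.sum_const, Finset.card_univ, Fintype.card_fin, nsmul_eq_mul] at c1 c2 c3
    push_cast at c1
    have c4 : ∑ i : Fin z, k7 (Job.Ja i : Job z) = z*(3*z) := by simp [k7]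
    have c5 : ∑ i : Fin z, k7 (Job.Jb i : Job z) = z*(3*z) := by simp [k7]
    have c6 : ∑ i : Fin z, k7 (Job.Jα i : Job z) = z*(4*z) := by simp [k7]
    have c7 : ∑ i : Fin z, k7 (Job.Jβ i : Job z) = z*(4*z-1) := by simp [k7]; ring
    rw [c4, c5, c6, c7]
    have c8 : ∑ i : Fin (z+1), k7 (Job.JA i : Job z) = 0 := by simp [k7]
    have c9 : ∑ i : Fin (z+1), k7 (Job.JB i : Job z) = 0 := by simp [k7]
    have c10 : ∑ i : Fin (3*z), k7 (Job.Jpart i : Job z) = 0 := by simp [k7]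
    rw [c8, c9, c10]
    simp only [k7] at *
    nlinarith
  have sp : ∑ j : Job z, kp ι j ≤ z * D := by
    rw [sum_job]; simp [kp]; exact_mod_cast hsum.le
  have sg : ∑ j : Job z, kg j ≤ (z:ℤ) := by rw [sum_job]; simp [kg]
  have b2 := B M k2 n2 _ s2
  have b3 := B M k3 n3 _ s3
  have b4 := B M k4 n4 _ s4
  have b5 := B M k5 n5 _ s5
  have b6 := B M k6 n6 _ s6
  have b7 := B M k7 n7 _ s7
  have bp := B M (kp ι) np _ sp
  have bg := B M kg ng _ sg
  have b2' := B M' k2 n2 _ s2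
  have b3' := B M' k3 n3 _ s3
  have b4' := B M' k4 n4 _ s4
  have b5' := B M' k5 n5 _ s5
  have b6' := B M' k6 n6 _ s6
  have b7' := B M' k7 n7 _ s7
  have bp' := B M' (kp ι) np _ sp
  have bg' := B M' kg ng _ sg
  have hD0 : (0:ℤ) < D := by exact_mod_cast hDpos
  have hb1 : 2*(z:ℤ)+2 < D := by linarith
  have hb2 : 3*(z:ℤ) < D := by linarith
  have hb3 : 28*(z:ℤ)*z+4*z < D := by linarith
  have q1 : (0:ℤ) ≤ D * TT σ (pJob z D ι) (mi ρ M kg) (σ i) := mul_nonneg hD0.le bg.1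
  have q2 : D * TT σ (pJob z D ι) (mi ρ M kg) (σ i) ≤ D * (z:ℤ) :=
    mul_le_mul_of_nonneg_left bg.2 hD0.le
  have q1' : (0:ℤ) ≤ D * TT σ (pJob z D ι) (mi ρ M' kg) (σ i) := mul_nonneg hD0.le bg'.1
  have q2' : D * TT σ (pJob z D ι) (mi ρ M' kg) (σ i) ≤ D * (z:ℤ) :=
    mul_le_mul_of_nonneg_left bg'.2 hD0.le
  have q3 : 2 * ((D:ℤ) * z) < D^2 := by
    have := mul_pos hD0 (show (0:ℤ) < D - 2*z by linarith)
    linarith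
  have q4 : (z:ℤ) * D = D * z := mul_comm _ _
  have fin := dig_all (D:ℤ)
    ((TT σ (pJob z D ι) (mi ρ M (kp ι)) (σ i) - D * TT σ (pJob z D ι) (mi ρ M kg) (σ i)) -
     (TT σ (pJob z D ι) (mi ρ M' (kp ι)) (σ i) - D * TT σ (pJob z D ι) (mi ρ M' kg) (σ i)))
    (TT σ (pJob z D ι) (mi ρ M k2) (σ i) - TT σ (pJob z D ι) (mi ρ M' k2) (σ i))
    (TT σ (pJob z D ι) (mi ρ M k3) (σ i) - TT σ (pJob z D ι) (mi ρ M' k3) (σ i))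
    (TT σ (pJob z D ι) (mi ρ M k4) (σ i) - TT σ (pJob z D ι) (mi ρ M' k4) (σ i))
    (TT σ (pJob z D ι) (mi ρ M k5) (σ i) - TT σ (pJob z D ι) (mi ρ M' k5) (σ i))
    (TT σ (pJob z D ι) (mi ρ M k6) (σ i) - TT σ (pJob z D ι) (mi ρ M' k6) (σ i))
    (TT σ (pJob z D ι) (mi ρ M k7) (σ i) - TT σ (pJob z D ι) (mi ρ M' k7) (σ i))
    (TT σ (pJob z D ι) (mi ρ M k8) (σ i) - TT σ (pJob z D ι) (mi ρ M' k8) (σ i))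
    (by linear_combination e' - e)
    (by rw [abs_lt]; constructor <;> linarith [bp.1, bp.2, bp'.1, bp'.2])
    (by rw [abs_lt]; constructor <;> linarith [b2.1, b2.2, b2'.1, b2'.2])
    (by rw [abs_lt]; constructor <;> linarith [b3.1, b3.2, b3'.1, b3'.2])
    (by rw [abs_lt]; constructor <;> linarith [b4.1, b4.2, b4'.1, b4'.2])
    (by rw [abs_lt]; constructor <;> linarith [b5.1, b5.2, b5'.1, b5'.2])
    (by rw [abs_lt]; constructor <;> linarith [b6.1, b6.2, b6'.1, b6'.2])
    (by rw [abs_lt]; constructor <;> linarith [b7.1, b7.2, b7'.1, b7'.2])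
  simp only [sub_eq_zero] at fin
  exact fin

theorem tot14 (z D : ℕ) (ι : Fin (3*z) → ℕ) (hz : 0 < z) (hDpos : 0 < D)
    (ρ : Job z → Finset ℕ) (hnf : NormalForm ρ) :
    (∑ j with 1 ∈ ρ j, pJob z D ι j = Wval z D) ∧ (∑ j with 4 ∈ ρ j, pJob z D ι j = Wval z D) := by
  obtain ⟨h1, h4, h23, ho⟩ := hnf
  constructor
  · rw [Finset.sum_filter, sum_job]
    simp only [h1, M1Jobs, if_true, if_false, pJob, Finset.sum_const, Finset.card_univ,
      Fintype.card_fin, smul_eq_mul, Wval]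
    ring
  · have h : 1 ≤ 4 * z := by omega
    zify
    rw [Finset.sum_filter, sum_job]
    simp only [h4, M4Jobs, if_true, if_false, pJob, Finset.sum_const, Finset.card_univ,
      Fintype.card_fin, nsmul_eq_mul, Wval, smul_eq_mul]
    push_cast [Nat.cast_sub h]
    ring

theorem tot23s (z D : ℕ) (ι : Fin (3*z) → ℕ) (hz : 0 < z) (hDpos : 0 < D)
    (hsum : ∑ i, ι i = z * D)
    (ρ : Job z → Finset ℕ) (hnf : NormalForm ρ) 
    (hcard : ∀ j, (ρ j).card = qJob z j) :
    (∑ j with 2 ∈ ρ j, pJob z D ι j) + (∑ j with 3 ∈ ρ j, pJob z D ι j) = 2 * Wval z D := by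
  obtain ⟨h1, h4, h23, ho⟩ := hnf
  have hs : ∀ (j : Job z) (M M' : ℕ), qJob z j = 1 → M ∈ ρ j → M' ≠ M → M' ∉ ρ j := by
    intro j M M' hq hM hne hM'
    have := hcard j
    rw [hq, Finset.card_eq_one] at this
    obtain ⟨x, hx⟩ := this
    rw [hx] at hM hM'
    simp at hM hM'
    omega
  have key : ∀ j, (if 2 ∈ ρ j then (pJob z D ι j : ℤ) else 0) + (if 3 ∈ ρ j then (pJob z D ι j : ℤ) else 0)
      = (match j with
        | .JA _ => 2 | .JB _ => 2 | .Jc _ => 2 | .Jα _ => 0 | .Jβ _ => 0 | .Jl1 => 0 | .Jl2 => 0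
        | _ => 1) * (kp ι j - D * kg j + D^2 * k2 j + D^3 * k3 j + D^4 * k4 j + D^5 * k5 j
      + D^6 * k6 j + D^7 * k7 j + D^8 * k8 j) := by
    intro j
    rw [← p_dig z D ι hDpos hz j]
    cases j with
    | JA i => have := h23 (.JA i) trivial; simp only [this.1, this.2, if_true]; ring
    | JB i => have := h23 (.JB i) trivial; simp only [this.1, this.2, if_true]; ring
    | Jc i => have := h23 (.Jc i) trivial; simp only [this.1, this.2, if_true]; ring
    | Jα i =>
      have m := (h1 (.Jα i)).2 trivial
      have n2 := hs _ 1 2 rfl m (by norm_num)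
      have n3 := hs _ 1 3 rfl m (by norm_num)
      simp [n2, n3]
    | Jβ i =>
      have m := (h4 (.Jβ i)).2 trivial
      have n2 := hs _ 4 2 rfl m (by norm_num)
      have n3 := hs _ 4 3 rfl m (by norm_num)
      simp [n2, n3]
    | Jl1 =>
      have m := (h1 (.Jl1)).2 trivial
      have n2 := hs _ 1 2 rfl m (by norm_num)
      have n3 := hs _ 1 3 rfl m (by norm_num)
      simp [n2, n3]
    | Jl2 =>
      have m := (h4 (.Jl2)).2 trivial
      have n2 := hs _ 4 2 rfl m (by norm_num)
      have n3 := hs _ 4 3 rfl m (by norm_num)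
      simp [n2, n3]
    | Ja i => have := ho (.Ja i) trivial; by_cases h : 3 ∈ ρ (.Ja i) <;> simp [this, h]
    | Jb i => have := ho (.Jb i) trivial; by_cases h : 3 ∈ ρ (.Jb i) <;> simp [this, h]
    | Jγ i => have := ho (.Jγ i) trivial; by_cases h : 3 ∈ ρ (.Jγ i) <;> simp [this, h]
    | Jδ i => have := ho (.Jδ i) trivial; by_cases h : 3 ∈ ρ (.Jδ i) <;> simp [this, h]
    | Jpart i => have := ho (.Jpart i) trivial; by_cases h : 3 ∈ ρ (.Jpart i) <;> simp [this, h]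
  have hsum' : ∑ i, (ι i : ℤ) = z * D := by exact_mod_cast hsum
  zify
  rw [Finset.sum_filter, Finset.sum_filter, ← Finset.sum_add_distrib, Finset.sum_congr rfl (fun j _ => key j), sum_job]
  have hc : ∑ i : Fin (z+1), (i.val : ℤ) = ∑ i : Fin z, ((i.val : ℤ) + 1) := by
    rw [Fin.sum_univ_succ]; simp
  simp only [kp, kg, k2, k3, k4, k5, k6, k7, k8, mul_zero, zero_mul, mul_one, one_mul, add_zero, zero_add, sub_zero, Finset.sum_const, Finset.card_univ,
      Fintype.card_fin, nsmul_eq_mul, hsum', Finset.sum_add_distrib, Finset.sum_sub_distrib, mul_add, mul_sub, ← Finset.mul_sum, hc, Wval]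
  push_cast
  ring

theorem tot23 (z D : ℕ) (ι : Fin (3*z) → ℕ) (hz : 0 < z) (hDpos : 0 < D)
    (hsum : ∑ i, ι i = z * D) (σ : Job z → ℕ)
    (ρ : Job z → Finset ℕ) (hnf : NormalForm ρ) 
    (hfeas : Feasible 4 (pJob z D ι) (qJob z) σ ρ)
    (hW : ∀ j, σ j + pJob z D ι j ≤ Wval z D) :
    (∑ j with 2 ∈ ρ j, pJob z D ι j = Wval z D) ∧ (∑ j with 3 ∈ ρ j, pJob z D ι j = Wval z D) := by
  have hs := tot23s z D ι hz hDpos hsum ρ hnf hfeas.2.1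
  have hle : ∀ M, ∑ j with M ∈ ρ j, pJob z D ι j ≤ Wval z D - 0 := by
    intro M
    apply pk_sum_le σ
    · intro j hj j' hj' hne
      simp only [Finset.mem_filter, Finset.mem_univ, true_and] at hj hj'
      exact hfeas.2.2 j j' hne ⟨M, Finset.mem_inter.2 ⟨hj, hj'⟩⟩
    · intros; omega
    · intro j _; exact hW j
  have := hle 2
  have := hle 3
  omega

def fm {z : ℕ} (ρ : Job z → Finset ℕ) (M : ℕ) (S : Finset (Job z)) : Finset (Job z) :=
  S.filter (fun j => M ∈ ρ j)

theorem nf_single {z D : ℕ} {ι : Fin (3*z) → ℕ} {σ : Job z → ℕ}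
    {ρ : Job z → Finset ℕ} (hnf : NormalForm ρ)
    (hfeas : Feasible 4 (pJob z D ι) (qJob z) σ ρ) (M : ℕ) (hM : M = 2 ∨ M = 3) :
    (∀ i, M ∉ ρ (.Jα i)) ∧ (∀ i, M ∉ ρ (.Jβ i)) ∧ M ∉ ρ .Jl1 ∧ M ∉ ρ .Jl2 := by
  obtain ⟨h1, h4, h23, ho⟩ := hnf
  have hs : ∀ (j : Job z) (M M' : ℕ), qJob z j = 1 → M ∈ ρ j → M' ≠ M → M' ∉ ρ j := by
    intro j M M' hq hM hne hM'
    have := hfeas.2.1 j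
    rw [hq, Finset.card_eq_one] at this
    obtain ⟨x, hx⟩ := this
    rw [hx] at hM hM'
    simp at hM hM'
    omega
  exact ⟨fun i => hs _ 1 M rfl ((h1 (.Jα i)).2 trivial) (by omega),
    fun i => hs _ 4 M rfl ((h4 (.Jβ i)).2 trivial) (by omega),
    hs _ 1 M rfl ((h1 .Jl1).2 trivial) (by omega),
    hs _ 4 M rfl ((h4 .Jl2).2 trivial) (by omega)⟩

theorem ev1 {z : ℕ} (σ p : Job z → ℕ) (ρ : Job z → Finset ℕ) (hnf : NormalForm ρ) (t : ℕ) :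
    TT σ p (mi ρ 1 k3) t = NN σ p (sα z) t + NN σ p {Job.Jl1} t ∧
    TT σ p (mi ρ 1 k4) t = NN σ p (fm ρ 2 (sa z)) t + NN σ p (fm ρ 3 (sa z)) t ∧
    TT σ p (mi ρ 1 k5) t = NN σ p (sα z) t ∧
    TT σ p (mi ρ 1 k6) t = NN σ p (fm ρ 2 (sa z)) t + NN σ p (fm ρ 3 (sa z)) t ∧
    TT σ p (mi ρ 1 k7) t = 3*z*(NN σ p (fm ρ 2 (sa z)) t + NN σ p (fm ρ 3 (sa z)) t) +
      4*z*NN σ p (sα z) t + z * NN σ p {Job.Jl1} t ∧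
    TT σ p (mi ρ 1 k8) t = NN σ p (sα z) t + NN σ p {Job.Jl1} t := by
  obtain ⟨h1, h4, h23, ho⟩ := hnf
  have ha := fun i => ho (.Ja i) trivial
  simp only [TT_NN, TT_add, TT_mul]
  refine ⟨?_, ?_, ?_, ?_, ?_, ?_⟩ <;>
  · congr 1
    funext j
    cases j with
    | Ja i =>
      by_cases h : 3 ∈ ρ (.Ja i) <;>
      simp [mi, h1, M1Jobs, k3, k4, k5, k6, k7, k8, fm, sa, sα, ha, h]
    | _ => simp [mi, h1, M1Jobs, k3, k4, k5, k6, k7, k8, fm, sa, sα]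

theorem ev4 {z : ℕ} (σ p : Job z → ℕ) (ρ : Job z → Finset ℕ) (hnf : NormalForm ρ) (t : ℕ) :
    TT σ p (mi ρ 4 k2) t = NN σ p (sβ z) t + NN σ p {Job.Jl2} t ∧
    TT σ p (mi ρ 4 k4) t = NN σ p (sβ z) t ∧
    TT σ p (mi ρ 4 k5) t = NN σ p (fm ρ 2 (sb z)) t + NN σ p (fm ρ 3 (sb z)) t ∧
    TT σ p (mi ρ 4 k6) t = NN σ p (fm ρ 2 (sb z)) t + NN σ p (fm ρ 3 (sb z)) t ∧
    TT σ p (mi ρ 4 k7) t = 3*z*(NN σ p (fm ρ 2 (sb z)) t + NN σ p (fm ρ 3 (sb z)) t) +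
      (4*z-1)*NN σ p (sβ z) t + 2*z * NN σ p {Job.Jl2} t ∧
    TT σ p (mi ρ 4 k8) t = NN σ p (sβ z) t + NN σ p {Job.Jl2} t := by
  obtain ⟨h1, h4, h23, ho⟩ := hnf
  have ha := fun i => ho (.Jb i) trivial
  simp only [TT_NN, TT_add, TT_mul]
  refine ⟨?_, ?_, ?_, ?_, ?_, ?_⟩ <;>
  · congr 1
    funext j
    cases j with
    | Jb i =>
      by_cases h : 3 ∈ ρ (.Jb i) <;>
      simp [mi, h4, M4Jobs, k2, k4, k5, k6, k7, k8, fm, sb, sβ, ha, h]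
    | _ => simp [mi, h4, M4Jobs, k2, k4, k5, k6, k7, k8, fm, sb, sβ]

theorem ev23 {z D : ℕ} {ι : Fin (3*z) → ℕ} (σ p : Job z → ℕ)
    (ρ : Job z → Finset ℕ) (hnf : NormalForm ρ)
    (hfeas : Feasible 4 (pJob z D ι) (qJob z) σ ρ) (M : ℕ) (hM : M = 2 ∨ M = 3) (t : ℕ) :
    TT σ p (mi ρ M k2) t = NN σ p (sA z) t ∧
    TT σ p (mi ρ M k3) t = NN σ p (sB z) t ∧
    TT σ p (mi ρ M k4) t = NN σ p (fm ρ M (sa z)) t + NN σ p (fm ρ M (sδ z)) t ∧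
    TT σ p (mi ρ M k5) t = NN σ p (fm ρ M (sb z)) t + NN σ p (fm ρ M (sγ z)) t ∧
    TT σ p (mi ρ M k6) t = NN σ p (fm ρ M (sa z)) t + NN σ p (fm ρ M (sb z)) t ∧
    TT σ p (mi ρ M k7) t = 3*z*(NN σ p (fm ρ M (sa z)) t + NN σ p (fm ρ M (sb z)) t) +
      3*z*(NN σ p (fm ρ M (sγ z)) t + NN σ p (fm ρ M (sδ z)) t) - TT σ p (mi ρ M wgd) t
      + z * NN σ p (sc z) t + TT σ p wc t ∧
    TT σ p (mi ρ M k8) t = NN σ p (sc z) t := by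
  obtain ⟨nα, nβ, n1, n2⟩ := nf_single hnf hfeas M hM
  obtain ⟨h1, h4, h23, ho⟩ := hnf
  have mm : ∀ j, BothM23 j → M ∈ ρ j := by
    intro j hj
    rcases hM with rfl | rfl
    · exact (h23 j hj).1
    · exact (h23 j hj).2
  have mA := fun i => mm (.JA i) trivial
  have mB := fun i => mm (.JB i) trivial
  have mc := fun i => mm (.Jc i) trivial
  simp only [TT_NN, TT_add, TT_mul, TT_sub]
  refine ⟨?_, ?_, ?_, ?_, ?_, ?_, ?_⟩ <;>
  · congr 1
    funext j
    cases j with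
    | Ja i =>
      by_cases h : M ∈ ρ (.Ja i) <;>
      simp [mi, k2, k3, k4, k5, k6, k7, k8, fm, sA, sB, sa, sb, sc, sγ, sδ, wgd, wc, h]
    | Jb i =>
      by_cases h : M ∈ ρ (.Jb i) <;>
      simp [mi, k2, k3, k4, k5, k6, k7, k8, fm, sA, sB, sa, sb, sc, sγ, sδ, wgd, wc, h]
    | Jγ i =>
      by_cases h : M ∈ ρ (.Jγ i) <;>
      simp [mi, k2, k3, k4, k5, k6, k7, k8, fm, sA, sB, sa, sb, sc, sγ, sδ, wgd, wc, h]
    | Jδ i =>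
      by_cases h : M ∈ ρ (.Jδ i) <;>
      simp [mi, k2, k3, k4, k5, k6, k7, k8, fm, sA, sB, sa, sb, sc, sγ, sδ, wgd, wc, h]
    | _ => simp [mi, k2, k3, k4, k5, k6, k7, k8, fm, sA, sB, sa, sb, sc, sγ, sδ, wgd, wc,
             mA, mB, mc, nα, nβ, n1, n2]

theorem mem_typ {z : ℕ} : (∀ j ∈ sA z, ∃ i, j = .JA i) ∧ (∀ j ∈ sB z, ∃ i, j = .JB i) ∧
    (∀ j ∈ sc z, ∃ i, j = .Jc i) ∧ (∀ j ∈ sa z, ∃ i, j = .Ja i) ∧ (∀ j ∈ sb z, ∃ i, j = .Jb i) := by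
  refine ⟨?_, ?_, ?_, ?_, ?_⟩ <;>
  · intro j hj
    simp only [sA, sB, sc, sa, sb, Finset.mem_image, Finset.mem_univ, true_and] at hj
    obtain ⟨i, rfl⟩ := hj
    exact ⟨i, rfl⟩

theorem pJob_pos {z D : ℕ} {ι : Fin (3*z) → ℕ} (hz : 0 < z) (hιpos : ∀ i, 0 < ι i)
    (hD : 4*z*(7*z+1) < D) (j : Job z) : 0 < pJob z D ι j := by
  have h0 : 0 < D := by omega
  cases j with
  | Jγ j =>
    have h1 : 1 < D := by nlinarith
    have h2 : D < D^5 := by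
      calc D = D^1 := (pow_one D).symm
        _ < D^5 := Nat.pow_lt_pow_right h1 (by norm_num)
    have := Nat.zero_le ((3*z - (j.val+1))*D^7)
    simp only [pJob]
    omega
  | Jpart i => exact hιpos i
  | _ => simp only [pJob]; positivity

theorem rel1 {z D : ℕ} {ι : Fin (3*z) → ℕ} (hz : 0 < z) (hDpos : 0 < D)
    (hsum : ∑ i, ι i = z * D) (hD : 4*z*(7*z+1) < D)
    {σ : Job z → ℕ} {ρ : Job z → Finset ℕ}
    (hfeas : Feasible 4 (pJob z D ι) (qJob z) σ ρ)
    (hW : ∀ j, σ j + pJob z D ι j ≤ Wval z D) (hnf : NormalForm ρ)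
    (M : ℕ) (hM : M = 2 ∨ M = 3) (i : Job z) (h1 : 1 ∈ ρ i) (h2 : M ∈ ρ i)
    (N : Finset (Job z) → ℤ) (hN : ∀ S, N S = NN σ (pJob z D ι) S (σ i)) :
    N (sα z) + N {Job.Jl1} = N (sB z) ∧ N (sα z) + N {Job.Jl1} = N (sc z) ∧
    N (sα z) = N (fm ρ M (sb z)) + N (fm ρ M (sγ z)) ∧
    N (fm ρ 2 (sa z)) + N (fm ρ 3 (sa z)) = N (fm ρ M (sa z)) + N (fm ρ M (sδ z)) ∧
    N (fm ρ 2 (sa z)) + N (fm ρ 3 (sa z)) = N (fm ρ M (sa z)) + N (fm ρ M (sb z)) ∧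
    TT σ (pJob z D ι) wc (σ i) = TT σ (pJob z D ι) (mi ρ M wgd) (σ i) := by
  have t1 := (tot14 z D ι hz hDpos ρ hnf).1
  have t23 := tot23 z D ι hz hDpos hsum σ ρ hnf hfeas hW
  have tM : ∑ j with M ∈ ρ j, pJob z D ι j = Wval z D := by
    rcases hM with rfl | rfl
    · exact t23.1
    · exact t23.2
  have d := dig_eq z D ι hz hDpos hsum hD σ ρ hfeas _ hW 1 M t1 tM i h1 h2
  obtain ⟨e3, e4, e5, e6, e7, e8⟩ := ev1 σ (pJob z D ι) ρ hnf (σ i)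
  obtain ⟨f2, f3, f4, f5, f6, f7, f8⟩ := ev23 σ (pJob z D ι) ρ hnf hfeas M hM (σ i)
  rw [e3, e4, e5, e6, e7, e8, f2, f3, f4, f5, f6, f7, f8] at d
  simp only [← hN] at d
  obtain ⟨d2, d3, d4, d5, d6, d7, d8⟩ := d
  refine ⟨d3, d8, d5, d4, d6, ?_⟩
  have hx : N (fm ρ M (sγ z)) + N (fm ρ M (sδ z)) = N (sα z) := by linarith
  rw [hx, ← d6, ← d8] at d7
  linarith

theorem rel4 {z D : ℕ} {ι : Fin (3*z) → ℕ} (hz : 0 < z) (hDpos : 0 < D)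
    (hsum : ∑ i, ι i = z * D) (hD : 4*z*(7*z+1) < D)
    {σ : Job z → ℕ} {ρ : Job z → Finset ℕ}
    (hfeas : Feasible 4 (pJob z D ι) (qJob z) σ ρ)
    (hW : ∀ j, σ j + pJob z D ι j ≤ Wval z D) (hnf : NormalForm ρ)
    (M : ℕ) (hM : M = 2 ∨ M = 3) (i : Job z) (h1 : 4 ∈ ρ i) (h2 : M ∈ ρ i)
    (N : Finset (Job z) → ℤ) (hN : ∀ S, N S = NN σ (pJob z D ι) S (σ i)) :
    N (sβ z) + N {Job.Jl2} = N (sA z) ∧ N (sβ z) + N {Job.Jl2} = N (sc z) ∧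
    N (sβ z) = N (fm ρ M (sa z)) + N (fm ρ M (sδ z)) ∧
    N (fm ρ 2 (sb z)) + N (fm ρ 3 (sb z)) = N (fm ρ M (sb z)) + N (fm ρ M (sγ z)) ∧
    N (fm ρ 2 (sb z)) + N (fm ρ 3 (sb z)) = N (fm ρ M (sa z)) + N (fm ρ M (sb z)) ∧
    TT σ (pJob z D ι) wc (σ i) = TT σ (pJob z D ι) (mi ρ M wgd) (σ i)
      + (z + 1) * N {Job.Jl2} - N (sc z) := by
  have t1 := (tot14 z D ι hz hDpos ρ hnf).2
  have t23 := tot23 z D ι hz hDpos hsum σ ρ hnf hfeas hW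
  have tM : ∑ j with M ∈ ρ j, pJob z D ι j = Wval z D := by
    rcases hM with rfl | rfl
    · exact t23.1
    · exact t23.2
  have d := dig_eq z D ι hz hDpos hsum hD σ ρ hfeas _ hW 4 M t1 tM i h1 h2
  obtain ⟨e3, e4, e5, e6, e7, e8⟩ := ev4 σ (pJob z D ι) ρ hnf (σ i)
  obtain ⟨f2, f3, f4, f5, f6, f7, f8⟩ := ev23 σ (pJob z D ι) ρ hnf hfeas M hM (σ i)
  rw [e3, e4, e5, e6, e7, e8, f2, f3, f4, f5, f6, f7, f8] at d
  simp only [← hN] at d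
  obtain ⟨d2, d3, d4, d5, d6, d7, d8⟩ := d
  refine ⟨d2, d8, d4, d5, d6, ?_⟩
  have hx : N (fm ρ M (sγ z)) + N (fm ρ M (sδ z)) = N (sβ z) := by linarith
  rw [hx, ← d6, ← d8] at d7
  rw [← d8]
  linarith

theorem relc {z D : ℕ} {ι : Fin (3*z) → ℕ} (hz : 0 < z) (hDpos : 0 < D)
    (hsum : ∑ i, ι i = z * D) (hD : 4*z*(7*z+1) < D)
    {σ : Job z → ℕ} {ρ : Job z → Finset ℕ}
    (hfeas : Feasible 4 (pJob z D ι) (qJob z) σ ρ)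
    (hW : ∀ j, σ j + pJob z D ι j ≤ Wval z D) (hnf : NormalForm ρ)
    (i : Job z) (h1 : 2 ∈ ρ i) (h2 : 3 ∈ ρ i) :
    NN σ (pJob z D ι) (fm ρ 2 (sa z)) (σ i) + NN σ (pJob z D ι) (fm ρ 2 (sb z)) (σ i) =
    NN σ (pJob z D ι) (fm ρ 3 (sa z)) (σ i) + NN σ (pJob z D ι) (fm ρ 3 (sb z)) (σ i) := by
  have t23 := tot23 z D ι hz hDpos hsum σ ρ hnf hfeas hW
  have d := dig_eq z D ι hz hDpos hsum hD σ ρ hfeas _ hW 2 3 t23.1 t23.2 i h1 h2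
  obtain ⟨f2, f3, f4, f5, f6, f7, f8⟩ := ev23 σ (pJob z D ι) ρ hnf hfeas 2 (by simp) (σ i)
  obtain ⟨g2, g3, g4, g5, g6, g7, g8⟩ := ev23 σ (pJob z D ι) ρ hnf hfeas 3 (by simp) (σ i)
  have := d.2.2.2.2.1
  rw [f6, g6] at this
  exact_mod_cast this

set_option maxHeartbeats 1000000 in
theorem mkHH {z D : ℕ} {ι : Fin (3*z) → ℕ} (hz : 0 < z) (hDpos : 0 < D)
    (hιpos : ∀ i, 0 < ι i)
    (hsum : ∑ i, ι i = z * D) (hD : 4*z*(7*z+1) < D)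
    {σ : Job z → ℕ} {ρ : Job z → Finset ℕ}
    (hfeas : Feasible 4 (pJob z D ι) (qJob z) σ ρ)
    (hW : ∀ j, σ j + pJob z D ι j ≤ Wval z D) (hnf : NormalForm ρ) :
    HH σ (pJob z D ι) (sA z) (sB z) (sc z) (fm ρ 2 (sa z)) (fm ρ 3 (sa z)) (fm ρ 2 (sb z))
      (fm ρ 3 (sb z)) (sα z) {Job.Jl1} (sβ z) {Job.Jl2} (fm ρ 2 (sγ z)) (fm ρ 3 (sγ z))
      (fm ρ 2 (sδ z)) (fm ρ 3 (sδ z)) := by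
  have R1 := fun M hM i h1 h2 =>
    rel1 hz hDpos hsum hD hfeas hW hnf M hM i h1 h2 (fun S => NN σ (pJob z D ι) S (σ i)) (fun _ => rfl)
  have R4 := fun M hM i h1 h2 =>
    rel4 hz hDpos hsum hD hfeas hW hnf M hM i h1 h2 (fun S => NN σ (pJob z D ι) S (σ i)) (fun _ => rfl)
  have RC := fun i h1 h2 => relc hz hDpos hsum hD hfeas hW hnf i h1 h2
  obtain ⟨tA, tB, tc, ta, tb⟩ := mem_typ (z := z)
  obtain ⟨n1, n4, n23, no⟩ := hnf
  have mem : ∀ M S j, j ∈ fm ρ M S → j ∈ S ∧ M ∈ ρ j := by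
    intro M S j hj; simpa [fm] using hj
  have mA : ∀ j ∈ sA z, 1 ∈ ρ j ∧ 2 ∈ ρ j ∧ 3 ∈ ρ j := by
    intro j hj
    obtain ⟨i, rfl⟩ := tA j hj
    exact ⟨(n1 _).2 trivial, n23 _ trivial⟩
  have mB : ∀ j ∈ sB z, 4 ∈ ρ j ∧ 2 ∈ ρ j ∧ 3 ∈ ρ j := by
    intro j hj
    obtain ⟨i, rfl⟩ := tB j hj
    exact ⟨(n4 _).2 trivial, n23 _ trivial⟩
  have mc : ∀ j ∈ sc z, 2 ∈ ρ j ∧ 3 ∈ ρ j := by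
    intro j hj
    obtain ⟨i, rfl⟩ := tc j hj
    exact n23 _ trivial
  have ma : ∀ j ∈ sa z, 1 ∈ ρ j := by
    intro j hj
    obtain ⟨i, rfl⟩ := ta j hj
    exact (n1 _).2 trivial
  have mb : ∀ j ∈ sb z, 4 ∈ ρ j := by
    intro j hj
    obtain ⟨i, rfl⟩ := tb j hj
    exact (n4 _).2 trivial
  have cm : ∀ M j j', j ≠ j' → M ∈ ρ j → M ∈ ρ j' → Cmp σ (pJob z D ι) j j' := by
    intro M j j' hne h h'
    exact hfeas.2.2 j j' hne ⟨M, Finset.mem_inter.2 ⟨h, h'⟩⟩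
  have nx : ∀ j, (2 ∈ ρ j ∧ 3 ∈ ρ j) → ∀ x, (x ∈ fm ρ 2 (sa z) ∨ x ∈ fm ρ 3 (sa z) ∨
      x ∈ fm ρ 2 (sb z) ∨ x ∈ fm ρ 3 (sb z)) → Cmp σ (pJob z D ι) j x := by
    rintro j ⟨h2, h3⟩ x hx
    have hxo : OneM23 x := by
      rcases hx with hx | hx | hx | hx
      · obtain ⟨i, rfl⟩ := ta x (mem _ _ _ hx).1; trivial
      · obtain ⟨i, rfl⟩ := ta x (mem _ _ _ hx).1; trivial
      · obtain ⟨i, rfl⟩ := tb x (mem _ _ _ hx).1; trivial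
      · obtain ⟨i, rfl⟩ := tb x (mem _ _ _ hx).1; trivial
    have hne : j ≠ x := by
      rintro rfl
      exact (no j hxo).1 h2 h3
    rcases hx with hx | hx | hx | hx
    · exact cm 2 j x hne h2 (mem _ _ _ hx).2
    · exact cm 3 j x hne h3 (mem _ _ _ hx).2
    · exact cm 2 j x hne h2 (mem _ _ _ hx).2
    · exact cm 3 j x hne h3 (mem _ _ _ hx).2
  refine ⟨pJob_pos hz hιpos hD, ?_, ?_, ?_, ?_, ?_, ?_, ?_, ?_, ?_, ?_, ?_, ?_, ?_, ?_, ?_⟩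
  · intro j hj
    have h := R1 2 (by simp) j (mA j hj).1 (mA j hj).2.1
    have h' := R1 3 (by simp) j (mA j hj).1 (mA j hj).2.2
    omega
  · intro j hj
    have h := R4 2 (by simp) j (mB j hj).1 (mB j hj).2.1
    have h' := R4 3 (by simp) j (mB j hj).1 (mB j hj).2.2
    omega
  · intro j hj
    have h := R1 2 (by simp) j (ma j (mem _ _ _ hj).1) (mem _ _ _ hj).2
    omega
  · intro j hj
    have h := R1 3 (by simp) j (ma j (mem _ _ _ hj).1) (mem _ _ _ hj).2
    omega
  · intro j hj
    have h := R4 2 (by simp) j (mb j (mem _ _ _ hj).1) (mem _ _ _ hj).2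
    omega
  · intro j hj
    have h := R4 3 (by simp) j (mb j (mem _ _ _ hj).1) (mem _ _ _ hj).2
    omega
  · intro j hj
    exact RC j (mc j hj).1 (mc j hj).2
  · intro j hj j' hj' hne
    exact cm 1 j j' hne (mA j hj).1 (mA j' hj').1
  · intro j hj j' hj' hne
    exact cm 4 j j' hne (mB j hj).1 (mB j' hj').1
  · intro j hj j' hj' hne
    exact cm 2 j j' hne (mc j hj).1 (mc j' hj').1
  · intro j hj x hx
    have hcB : x ∈ sc z ∨ x ∈ sB z → Cmp σ (pJob z D ι) j x := by
      intro h
      obtain ⟨i, rfl⟩ := tA j hj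
      rcases h with h | h
      · obtain ⟨i', rfl⟩ := tc x h
        exact cm 2 _ _ (by simp) (mA _ hj).2.1 (mc _ h).1
      · obtain ⟨i', rfl⟩ := tB x h
        exact cm 2 _ _ (by simp) (mA _ hj).2.1 (mB _ h).2.1
    have hn := nx j (mA j hj).2 x
    rcases hx with h | h | h | h | h | h
    · exact hn (Or.inl h)
    · exact hn (Or.inr (Or.inl h))
    · exact hn (Or.inr (Or.inr (Or.inl h)))
    · exact hn (Or.inr (Or.inr (Or.inr h)))
    · exact hcB (Or.inl h)
    · exact hcB (Or.inr h)
  · intro j hj x hx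
    have hcB : x ∈ sc z ∨ x ∈ sA z → Cmp σ (pJob z D ι) j x := by
      intro h
      obtain ⟨i, rfl⟩ := tB j hj
      rcases h with h | h
      · obtain ⟨i', rfl⟩ := tc x h
        exact cm 2 _ _ (by simp) (mB _ hj).2.1 (mc _ h).1
      · obtain ⟨i', rfl⟩ := tA x h
        exact cm 2 _ _ (by simp) (mB _ hj).2.1 (mA _ h).2.1
    have hn := nx j (mB j hj).2 x
    rcases hx with h | h | h | h | h | h
    · exact hn (Or.inl h)
    · exact hn (Or.inr (Or.inl h))
    · exact hn (Or.inr (Or.inr (Or.inl h)))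
    · exact hn (Or.inr (Or.inr (Or.inr h)))
    · exact hcB (Or.inl h)
    · exact hcB (Or.inr h)
  · intro j hj x hx
    exact nx j (mc j hj) x hx
  · intro x hx y hy
    have hne : x ≠ y := by
      rintro rfl
      obtain ⟨i, rfl⟩ := ta x (mem _ _ _ hx).1
      exact (no (.Ja i) trivial).1 (mem _ _ _ hx).2 (mem _ _ _ hy).2
    exact cm 1 x y hne (ma _ (mem _ _ _ hx).1) (ma _ (mem _ _ _ hy).1)
  · intro x hx y hy
    have hne : x ≠ y := by
      rintro rfl
      obtain ⟨i, rfl⟩ := tb x (mem _ _ _ hx).1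
      exact (no (.Jb i) trivial).1 (mem _ _ _ hx).2 (mem _ _ _ hy).2
    exact cm 4 x y hne (mb _ (mem _ _ _ hx).1) (mb _ (mem _ _ _ hy).1)

theorem KK {z D : ℕ} {ι : Fin (3*z) → ℕ} (hz : 0 < z) (hDpos : 0 < D)
    (hιpos : ∀ i, 0 < ι i)
    (hsum : ∑ i, ι i = z * D) (hD : 4*z*(7*z+1) < D)
    {σ : Job z → ℕ} {ρ : Job z → Finset ℕ}
    (hfeas : Feasible 4 (pJob z D ι) (qJob z) σ ρ)
    (hW : ∀ j, σ j + pJob z D ι j ≤ Wval z D) (hnf : NormalForm ρ) (p : Job z → ℕ)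
    (hp : p = pJob z D ι) :
    (∀ j0 ∈ sA z, ∀ j1 ∈ sB z, σ j0 ≤ σ j1 → NN σ p (sc z) (σ j0) = NN σ p (sc z) (σ j1) →
      1 ≤ NN σ p (sc z) (σ j0) → NN σ p (sc z) (σ j0) ≤ z →
        NN σ p {Job.Jl2} (σ j1) = 0 ∧ NN σ p {Job.Jl1} (σ j0) = 1) ∧
    (∀ j0 ∈ sB z, ∀ j1 ∈ sA z, σ j0 ≤ σ j1 → NN σ p (sc z) (σ j0) = NN σ p (sc z) (σ j1) →
      1 ≤ NN σ p (sc z) (σ j0) → NN σ p (sc z) (σ j0) ≤ z → NN σ p {Job.Jl1} (σ j1) = 0) := by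
  have h := mkHH hz hDpos hιpos hsum hD hfeas hW hnf
  have RA : ∀ j ∈ sA z, TT σ p wc (σ j) = TT σ p (mi ρ 2 wgd) (σ j) := by
    intro j hj
    obtain ⟨i, rfl⟩ := mem_typ.1 j hj
    subst hp
    exact (rel1 hz hDpos hsum hD hfeas hW hnf 2 (by simp) _ ((hnf.1 (.JA i)).2 trivial)
      (hnf.2.2.1 (.JA i) trivial).1 _ (fun _ => rfl)).2.2.2.2.2
  have RB : ∀ j ∈ sB z, TT σ p wc (σ j) = TT σ p (mi ρ 2 wgd) (σ j)
      + (z + 1) * (NN σ p {Job.Jl2} (σ j) : ℤ) - (NN σ p (sc z) (σ j) : ℤ) := by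
    intro j hj
    obtain ⟨i, rfl⟩ := mem_typ.2.1 j hj
    subst hp
    exact (rel4 hz hDpos hsum hD hfeas hW hnf 2 (by simp) _ ((hnf.2.1 (.JB i)).2 trivial)
      (hnf.2.2.1 (.JB i) trivial).1 _ (fun _ => rfl)).2.2.2.2.2
  rw [← hp] at h
  have hC : ∀ t t', t ≤ t' → NN σ p (sc z) t = NN σ p (sc z) t' → TT σ p wc t = TT σ p wc t' := by
    intro t t' htt hc
    refine TT_same _ (sc z) (sc z) ?_ htt hc hc
    intro j hj
    cases j <;> simp [wc, sc] at hj ⊢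
  have hG : ∀ t t', t ≤ t' → NN σ p (fm ρ 2 (sγ z)) t + NN σ p (fm ρ 2 (sδ z)) t =
      NN σ p (fm ρ 2 (sγ z)) t' + NN σ p (fm ρ 2 (sδ z)) t' →
      TT σ p (mi ρ 2 wgd) t = TT σ p (mi ρ 2 wgd) t' := by
    intro t t' htt hc
    have m1 := NN_mono (σ := σ) (p := p) (S := fm ρ 2 (sγ z)) htt
    have m2 := NN_mono (σ := σ) (p := p) (S := fm ρ 2 (sδ z)) htt
    refine TT_same _ (fm ρ 2 (sγ z)) (fm ρ 2 (sδ z)) ?_ htt (by omega) (by omega)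
    intro j hj
    have hj2 : 2 ∈ ρ j := by
      by_contra hn
      simp [mi, hn] at hj
    cases j <;> simp [mi, wgd, fm, sγ, sδ, hj2] at hj ⊢
  have hM : ∀ t t', t ≤ t' → TT σ p (mi ρ 2 wgd) t ≤ TT σ p (mi ρ 2 wgd) t' := by
    intro t t' htt
    refine TT_mono _ ?_ htt
    intro j
    unfold mi
    split_ifs
    · cases j <;> simp [wgd] <;> omega
    · exact le_rfl
  have l1c : ∀ t, NN σ p {Job.Jl1} t ≤ 1 := fun t => NN_le_card.trans (by simp)
  have l2c : ∀ t, NN σ p {Job.Jl2} t ≤ 1 := fun t => NN_le_card.trans (by simp)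
  constructor
  · intro j0 h0 j1 h1 hle hc hc1 hcz
    have a := h.fA j0 h0
    have b := h.fB j1 h1
    have ra := RA j0 h0
    have rb := RB j1 h1
    have ec := hC _ _ hle hc
    have eM := hM _ _ hle
    have eG := hG _ _ hle
    have x1 := l1c (σ j0)
    have x2 := l2c (σ j1)
    have hl2 : NN σ p {Job.Jl2} (σ j1) = 0 := by
      by_contra hne
      have : NN σ p {Job.Jl2} (σ j1) = 1 := by omega
      rw [this] at rb
      push_cast at rb
      omega
    refine ⟨hl2, ?_⟩
    by_contra hne
    have := eG (by omega)
    rw [hl2] at rb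
    push_cast at rb
    omega
  · intro j0 h0 j1 h1 hle hc hc1 hcz
    have a := h.fA j1 h1
    have b := h.fB j0 h0
    have ra := RA j1 h1
    have rb := RB j0 h0
    have ec := hC _ _ hle hc
    have eM := hM _ _ hle
    have eG := hG _ _ hle
    have x1 := l1c (σ j1)
    have x2 := l2c (σ j0)
    have hl2 : NN σ p {Job.Jl2} (σ j0) = 1 := by
      by_contra hne
      have : NN σ p {Job.Jl2} (σ j0) = 0 := by omega
      rw [this] at rb
      push_cast at rb
      omega
    by_contra hne
    have := eG (by omega)
    rw [hl2] at rb
    push_cast at rb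
    omega

theorem card_two {z : ℕ} {ρ : Job z → Finset ℕ} (S : Finset (Job z)) 
    (h : ∀ j ∈ S, (2 ∈ ρ j ↔ ¬ 3 ∈ ρ j)) : (fm ρ 2 S).card + (fm ρ 3 S).card = S.card := by
  have : fm ρ 2 S = S.filter (fun j => ¬ 3 ∈ ρ j) := Finset.filter_congr h
  rw [this, add_comm]
  exact Finset.card_filter_add_card_filter_not _

/-- If the job starting at time 0 on machine 2 is in `B`, then for every
`i ∈ {0,…,z}`: `#_{Aᵢ} λ₁ = 1` and `#_{Aᵢ} B − #_{Aᵢ} λ₁ = #_{Aᵢ} A = i`; in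
particular `λ₁` finishes before every job of `A` starts (`A` and `B` alternate). -/
theorem A_B_alternate
    (z D : ℕ) (ι : Fin (3*z) → ℕ)
    (hz : 0 < z) (hDpos : 0 < D)
    (hιpos : ∀ i, 0 < ι i)
    (hsum : ∑ i, ι i = z * D)
    (hlow : ∀ i, D < 4 * ι i)
    (hhigh : ∀ i, 2 * ι i < D)
    (hD : 4*z*(7*z+1) < D)
    (σ : Job z → ℕ) (ρ : Job z → Finset ℕ)
    (hfeas : Feasible 4 (pJob z D ι) (qJob z) σ ρ)
    (hmk : makespan (pJob z D ι) σ = Wval z D)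
    (hnf : NormalForm ρ)
    (Aenum : Fin (z+1) → Job z)
    (hAmem : ∀ i, Aenum i ∈ sA z)
    (hAinj : Function.Injective Aenum)
    (hAmono : Monotone fun i => σ (Aenum i))
    (hfirst : ∃ j ∈ sB z, 2 ∈ ρ j ∧ σ j = 0) :
    ∀ i : Fin (z+1),
      cnt (pJob z D ι) σ {Job.Jl1} (Aenum i) = 1 ∧
      (cnt (pJob z D ι) σ (sB z) (Aenum i) : ℤ) -
          cnt (pJob z D ι) σ {Job.Jl1} (Aenum i) =
        cnt (pJob z D ι) σ (sA z) (Aenum i) ∧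
      cnt (pJob z D ι) σ (sA z) (Aenum i) = i.val ∧
      σ Job.Jl1 + pJob z D ι Job.Jl1 ≤ σ (Aenum i) := by

  have hW : ∀ j, σ j + pJob z D ι j ≤ Wval z D := by
    intro j
    rw [← hmk]
    exact Finset.le_sup (f := fun j => σ j + pJob z D ι j) (Finset.mem_univ j)
  have h := mkHH hz hDpos hιpos hsum hD hfeas hW hnf
  obtain ⟨K1, K2⟩ := KK hz hDpos hιpos hsum hD hfeas hW hnf _ rfl
  have cA : (sA z).card = z + 1 := by
    rw [sA, Finset.card_image_of_injective _ (fun a b h => by simpa using h)]; simp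
  have cB : (sB z).card = z + 1 := by
    rw [sB, Finset.card_image_of_injective _ (fun a b h => by simpa using h)]; simp
  have cal : (sα z).card = z := by
    rw [sα, Finset.card_image_of_injective _ (fun a b h => by simpa using h)]; simp
  have cbe : (sβ z).card = z := by
    rw [sβ, Finset.card_image_of_injective _ (fun a b h => by simpa using h)]; simp
  have cγ : (sγ z).card = z := by
    rw [sγ, Finset.card_image_of_injective _ (fun a b h => by simpa using h)]; simp
  have cδ : (sδ z).card = z := by
    rw [sδ, Finset.card_image_of_injective _ (fun a b h => by simpa using h)]; simp
  have cg : (fm ρ 2 (sγ z)).card + (fm ρ 3 (sγ z)).card = z := by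
    rw [card_two, cγ]
    intro j hj
    simp only [sγ, Finset.mem_image, Finset.mem_univ, true_and] at hj
    obtain ⟨i, rfl⟩ := hj
    exact hnf.2.2.2 _ trivial
  have cd : (fm ρ 2 (sδ z)).card + (fm ρ 3 (sδ z)).card = z := by
    rw [card_two, cδ]
    intro j hj
    simp only [sδ, Finset.mem_image, Finset.mem_univ, true_and] at hj
    obtain ⟨i, rfl⟩ := hj
    exact hnf.2.2.2 _ trivial
  have ST := fun n => h.step z n cA cB (by simp) (by simp) cg cd K1 K2 cal cbe
  have P : ∀ n, n ≤ z → ∃ B0 ∈ sB z, NN σ (pJob z D ι) (sA z) (σ B0) = n ∧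
      NN σ (pJob z D ι) (sB z) (σ B0) = n ∧
      NN σ (pJob z D ι) (fm ρ 2 (sa z)) (σ B0) + NN σ (pJob z D ι) (fm ρ 3 (sa z)) (σ B0) ≤ n := by
    intro n
    induction n with
    | zero =>
      intro _
      obtain ⟨j, hj, _, h0⟩ := hfirst
      have hN : ∀ S, NN σ (pJob z D ι) S (σ j) = 0 := by
        intro S
        rw [NN, Finset.card_eq_zero, Finset.filter_eq_empty_iff]
        intro x _
        have := h.pos x
        omega
      exact ⟨j, hj, hN _, hN _, by rw [hN, hN]⟩
    | succ n ih =>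
      intro hn
      obtain ⟨B0, hB0, e1, e2, e3⟩ := ih (by omega)
      obtain ⟨A0, hA0, e4⟩ := NN_rank (S := sA z) h.pos h.cAA n (by omega)
      exact (ST n B0 hB0 e1 e2 e3 A0 hA0 e4).2.2 hn
  intro i
  have himg : Finset.univ.image Aenum = sA z := by
    apply Finset.eq_of_subset_of_card_le
    · intro x hx
      simp only [Finset.mem_image, Finset.mem_univ, true_and] at hx
      obtain ⟨k, rfl⟩ := hx
      exact hAmem k
    · rw [Finset.card_image_of_injective _ hAinj, cA]; simp
  have hrank : NN σ (pJob z D ι) (sA z) (σ (Aenum i)) = i.val := by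
    rw [NN, ← himg, Finset.filter_image, Finset.card_image_of_injective _ hAinj]
    have : (Finset.univ.filter fun k => σ (Aenum k) + pJob z D ι (Aenum k) ≤ σ (Aenum i)) =
        Finset.Iio i := by
      ext k
      simp only [Finset.mem_filter, Finset.mem_univ, true_and, Finset.mem_Iio]
      have hp := h.pos (Aenum k)
      have hp' := h.pos (Aenum i)
      constructor
      · intro hk
        by_contra hn
        have : σ (Aenum i) ≤ σ (Aenum k) := hAmono (not_lt.1 hn)
        omega
      · intro hk
        have hm : σ (Aenum k) ≤ σ (Aenum i) := hAmono hk.le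
        rcases h.cAA _ (hAmem k) _ (hAmem i) (fun e => hk.ne (hAinj e)) with h' | h'
        · exact h'
        · omega
    rw [this, Fin.card_Iio]
  obtain ⟨B0, hB0, e1, e2, e3⟩ := P i.val (by omega)
  obtain ⟨r1, r2, _⟩ := ST i.val B0 hB0 e1 e2 e3 (Aenum i) (hAmem i) hrank
  have c1 : cnt (pJob z D ι) σ {Job.Jl1} (Aenum i) = 1 := r2
  have c2 : cnt (pJob z D ι) σ (sB z) (Aenum i) = i.val + 1 := r1
  have c3 : cnt (pJob z D ι) σ (sA z) (Aenum i) = i.val := hrank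
  refine ⟨c1, by rw [c1, c2, c3]; push_cast; ring, c3, ?_⟩
  by_contra hn
  rw [cnt, Finset.filter_singleton, if_neg hn] at c1
  simp at c1
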